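/- arXiv:1605.07394 — 2 statements merged into one kernel-verified Lean document; each statement's English description precedes it below -/
import Mathlib

section
/- Let n > 2, p ≥ (n+2)/(n-2), and let w be a positive unbounded C² solution of w'' + ((n-1)/r + r/2) w' + w/(p-1) + w^p = 0 on (0,∞); if p = (n+2)/(n-2), assume additionally that w(r) - L r^{-2/(p-1)} changes sign only finitely many times. Then w(r) = L r^{-2/(p-1)} for all r > 0, where L^{p-1} = (2/(p-1)²)((n-2)p - n). -/
open Set Filter

structure Sol (p α b L : ℝ) (V V1 : ℝ → ℝ) : Prop where
  hp : 1 < p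
  ha : 0 < α
  hb : 0 ≤ b
  hap : α * (p - 1) = 2
  hL : 0 < L
  hLp : L ^ (p - 1) = α * (α + b)
  pos : ∀ t, 0 < V t
  d0 : ∀ t, HasDerivAt V (V1 t) t
  d1 : ∀ t, HasDerivAt V1 ((b + Real.exp (-2 * t) / 2) * V1 t + α * (α + b) * V t - V t ^ p) t

noncomputable def GG (p A x : ℝ) : ℝ := x ^ (p + 1) / (p + 1) - A * x ^ 2 / 2

noncomputable def EE (p A : ℝ) (V V1 : ℝ → ℝ) (t : ℝ) : ℝ := V1 t ^ 2 / 2 + GG p A (V t)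

lemma GG_min {p L x : ℝ} (hp : 1 < p) (hL : 0 < L) (hx : 0 < x) (hne : x ≠ L) :
    GG p (L ^ (p - 1)) L < GG p (L ^ (p - 1)) x := by
  have h1 : -1 ≤ (x / L) ^ 2 - 1 := by nlinarith [sq_nonneg (x / L)]
  have h2 : (x / L) ^ 2 - 1 ≠ 0 := by
    intro h
    have h3 : (x / L) ^ 2 = 1 := by linarith
    have h4 : 0 < x / L := by positivity
    have h5 : x / L = 1 := by nlinarith
    exact hne (by field_simp at h5; exact h5)
  have h3 := one_add_mul_self_lt_rpow_one_add h1 h2 (show 1 < (p + 1) / 2 by linarith)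
  have h4 : (1 + ((x / L) ^ 2 - 1)) ^ ((p + 1) / 2) = x ^ (p + 1) / L ^ (p + 1) := by
    have : 1 + ((x / L) ^ 2 - 1) = (x / L) ^ (2 : ℝ) := by norm_num
    rw [this, ← Real.rpow_mul (by positivity), Real.div_rpow hx.le hL.le]
    congr 2 <;> ring
  rw [h4] at h3
  have e1 : L ^ (p + 1) = L ^ (p - 1) * L ^ 2 := by
    rw [← Real.rpow_natCast, ← Real.rpow_add hL]; congr 1; push_cast; ring
  have hA : 0 < L ^ (p - 1) := by positivity
  have hL1 : 0 < L ^ (p + 1) := by positivity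
  rw [lt_div_iff₀ hL1] at h3
  unfold GG
  rw [e1] at h3 ⊢
  have h5 : (x / L) ^ 2 * L ^ 2 = x ^ 2 := by field_simp
  have hp1 : 0 < p + 1 := by linarith
  have h6 : L ^ (p - 1) * L ^ 2 + (p + 1) / 2 * (L ^ (p - 1) * (x ^ 2 - L ^ 2)) < x ^ (p + 1) := by
    rw [← h5]; linarith
  have h7 := div_lt_div_of_pos_right h6 hp1
  have h8 : (L ^ (p - 1) * L ^ 2 + (p + 1) / 2 * (L ^ (p - 1) * (x ^ 2 - L ^ 2))) / (p + 1)
    = L ^ (p - 1) * L ^ 2 / (p + 1) + (L ^ (p - 1) * (x ^ 2 - L ^ 2)) / 2 := by field_simp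
  linarith

lemma rpow_p1 {p x : ℝ} (hx : 0 < x) : x ^ (p + 1) = x ^ (p - 1) * x ^ 2 := by
  rw [← Real.rpow_natCast, ← Real.rpow_add hx]; congr 1; push_cast; ring

lemma rpow_p0 {p x : ℝ} (hx : 0 < x) : x ^ p = x ^ (p - 1) * x := by
  nth_rw 3 [← Real.rpow_one x]
  rw [← Real.rpow_add hx]; congr 1; ring

lemma GG_neg {p L x : ℝ} (hp : 1 < p) (hL : 0 < L) (hx : 0 < x) (hne : x ≤ L) :
    GG p (L ^ (p - 1)) x < 0 := by
  unfold GG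
  rw [rpow_p1 hx]
  have h1 : x ^ (p - 1) ≤ L ^ (p - 1) := Real.rpow_le_rpow hx.le hne (by linarith)
  have h2 : 0 < L ^ (p - 1) * x ^ 2 := by positivity
  have h3 : x ^ (p - 1) * x ^ 2 / (p + 1) < L ^ (p - 1) * x ^ 2 / 2 := by
    rw [div_lt_div_iff₀ (by linarith) (by norm_num)]
    nlinarith [mul_le_mul_of_nonneg_right h1 (sq_nonneg x)]
  linarith

lemma GG_cont {p A x : ℝ} (hp : 1 < p) : ContinuousAt (GG p A) x := by
  unfold GG
  have : ContinuousAt (fun x : ℝ => x ^ (p + 1)) x :=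
    Real.continuousAt_rpow_const _ _ (Or.inr (by linarith))
  fun_prop

namespace Sol
variable {p α b L : ℝ} {V V1 : ℝ → ℝ}

lemma dE (h : Sol p α b L V V1) (t : ℝ) :
    HasDerivAt (EE p (L ^ (p - 1)) V V1) ((b + Real.exp (-2 * t) / 2) * V1 t ^ 2) t := by
  have hp := h.hp
  have h1 := ((h.d1 t).pow 2).div_const 2
  have h2 := ((h.d0 t).rpow_const (p := p + 1) (Or.inl (h.pos t).ne')).div_const (p + 1)
  have h3 := (((h.d0 t).pow 2).const_mul (L ^ (p - 1))).div_const 2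
  refine (h1.add (h2.sub h3)).congr_deriv ?_
  rw [h.hLp]
  have : p + 1 ≠ 0 := by linarith
  have e : p + 1 - 1 = p := by ring
  rw [e]
  field_simp
  ring

lemma mono (h : Sol p α b L V V1) : Monotone (EE p (L ^ (p - 1)) V V1) := by
  apply monotone_of_deriv_nonneg (fun t => (h.dE t).differentiableAt)
  intro t
  rw [(h.dE t).deriv]
  have := h.hb
  positivity

lemma finish (h : Sol p α b L V V1)
    (hE : Tendsto (EE p (L ^ (p - 1)) V V1) atTop (nhds (GG p (L ^ (p - 1)) L))) (t : ℝ) :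
    V t = L := by
  by_contra hne
  have h1 := GG_min h.hp h.hL (h.pos t) hne
  have h2 := h.mono.ge_of_tendsto hE t
  unfold EE at h2
  nlinarith [sq_nonneg (V1 t)]

lemma ge_pow (h : Sol p α b L V V1) {t : ℝ} (ht : L ≤ V t) :
    α * (α + b) * V t - V t ^ p ≤ 0 := by
  rw [← h.hLp, rpow_p0 (h.pos t)]
  have := Real.rpow_le_rpow h.hL.le ht (show 0 ≤ p - 1 by linarith [h.hp])
  nlinarith [h.pos t]

lemma le_pow (h : Sol p α b L V V1) {t : ℝ} (ht : V t ≤ L) :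
    0 ≤ α * (α + b) * V t - V t ^ p := by
  rw [← h.hLp, rpow_p0 (h.pos t)]
  have := Real.rpow_le_rpow (h.pos t).le ht (show 0 ≤ p - 1 by linarith [h.hp])
  nlinarith [h.pos t]

/-- integrating factor -/
lemma dJ (h : Sol p α b L V V1) (t : ℝ) :
    HasDerivAt (fun t => Real.exp (-b * t + Real.exp (-2 * t) / 4) * V1 t)
      (Real.exp (-b * t + Real.exp (-2 * t) / 4) * (α * (α + b) * V t - V t ^ p)) t := by
  have h1 : HasDerivAt (fun t : ℝ => -b * t + Real.exp (-2 * t) / 4)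
      (-b - Real.exp (-2 * t) / 2) t := by
    have h2 : HasDerivAt (fun t : ℝ => Real.exp (-2 * t)) (Real.exp (-2 * t) * (-2 * 1)) t :=
      ((hasDerivAt_id t).const_mul (-2)).exp
    refine (((hasDerivAt_id t).const_mul (-b)).add (h2.div_const 4)).congr_deriv ?_
    ring
  refine (h1.exp.mul (h.d1 t)).congr_deriv ?_
  ring

lemma anti_of_le (h : Sol p α b L V V1) {T : ℝ} (hT : ∀ t ≥ T, V1 t ≤ 0) :
    AntitoneOn V (Ici T) := by
  apply antitoneOn_of_deriv_nonpos (convex_Ici T)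
    (fun t _ => (h.d0 t).continuousAt.continuousWithinAt)
    (fun t _ => (h.d0 t).differentiableAt.differentiableWithinAt)
  intro t ht
  rw [interior_Ici] at ht
  rw [(h.d0 t).deriv]
  exact hT t (le_of_lt ht)

lemma mono_of_ge (h : Sol p α b L V V1) {T : ℝ} (hT : ∀ t ≥ T, 0 ≤ V1 t) :
    MonotoneOn V (Ici T) := by
  apply monotoneOn_of_deriv_nonneg (convex_Ici T)
    (fun t _ => (h.d0 t).continuousAt.continuousWithinAt)
    (fun t _ => (h.d0 t).differentiableAt.differentiableWithinAt)
  intro t ht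
  rw [interior_Ici] at ht
  rw [(h.d0 t).deriv]
  exact hT t (le_of_lt ht)

lemma sign_of_ge (h : Sol p α b L V V1) {T : ℝ} (hT : ∀ t ≥ T, L ≤ V t) :
    ∃ T', (∀ t ≥ T', V1 t ≤ 0) ∨ (∀ t ≥ T', 0 ≤ V1 t) := by
  have hJ : AntitoneOn (fun t => Real.exp (-b * t + Real.exp (-2 * t) / 4) * V1 t) (Ici T) := by
    apply antitoneOn_of_deriv_nonpos (convex_Ici T)
      (fun t _ => (h.dJ t).continuousAt.continuousWithinAt)
      (fun t _ => (h.dJ t).differentiableAt.differentiableWithinAt)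
    intro t ht
    rw [interior_Ici] at ht
    rw [(h.dJ t).deriv]
    exact mul_nonpos_of_nonneg_of_nonpos (Real.exp_pos _).le (h.ge_pow (hT t (le_of_lt ht)))
  by_cases hc : ∀ t ≥ T, 0 ≤ V1 t
  · exact ⟨T, Or.inr hc⟩
  · push Not at hc
    obtain ⟨s, hs, hs1⟩ := hc
    refine ⟨s, Or.inl fun t ht => ?_⟩
    have := hJ (show s ∈ Ici T from hs) (show t ∈ Ici T from le_trans hs ht) ht
    simp only at this
    by_contra hcon
    push Not at hcon
    have h1 := mul_pos (Real.exp_pos (-b * t + Real.exp (-2 * t) / 4)) hcon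
    have h2 := mul_neg_of_pos_of_neg (Real.exp_pos (-b * s + Real.exp (-2 * s) / 4)) hs1
    linarith

lemma sign_of_le (h : Sol p α b L V V1) {T : ℝ} (hT : ∀ t ≥ T, V t ≤ L) :
    ∃ T', (∀ t ≥ T', V1 t ≤ 0) ∨ (∀ t ≥ T', 0 ≤ V1 t) := by
  have hJ : MonotoneOn (fun t => Real.exp (-b * t + Real.exp (-2 * t) / 4) * V1 t) (Ici T) := by
    apply monotoneOn_of_deriv_nonneg (convex_Ici T)
      (fun t _ => (h.dJ t).continuousAt.continuousWithinAt)
      (fun t _ => (h.dJ t).differentiableAt.differentiableWithinAt)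
    intro t ht
    rw [interior_Ici] at ht
    rw [(h.dJ t).deriv]
    exact mul_nonneg (Real.exp_pos _).le (h.le_pow (hT t (le_of_lt ht)))
  by_cases hc : ∀ t ≥ T, V1 t ≤ 0
  · exact ⟨T, Or.inl hc⟩
  · push Not at hc
    obtain ⟨s, hs, hs1⟩ := hc
    refine ⟨s, Or.inr fun t ht => ?_⟩
    have := hJ (show s ∈ Ici T from hs) (show t ∈ Ici T from le_trans hs ht) ht
    simp only at this
    by_contra hcon
    push Not at hcon
    have h1 := mul_neg_of_pos_of_neg (Real.exp_pos (-b * t + Real.exp (-2 * t) / 4)) hcon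
    have h2 := mul_pos (Real.exp_pos (-b * s + Real.exp (-2 * s) / 4)) hs1
    linarith

/-- V has a limit l: then E tends to G(l) -/
lemma lim_E (h : Sol p α b L V V1) {l : ℝ} (hl : Tendsto V atTop (nhds l)) :
    Tendsto (EE p (L ^ (p - 1)) V V1) atTop (nhds (GG p (L ^ (p - 1)) l)) := by
  have hx : ∀ t : ℝ, ∃ ξ ∈ Ioo t (t + 1), V1 ξ = V (t + 1) - V t := by
    intro t
    obtain ⟨ξ, h1, h2⟩ := exists_hasDerivAt_eq_slope V V1 (show t < t + 1 by linarith)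
      (fun t _ => (h.d0 t).continuousAt.continuousWithinAt) (fun t _ => h.d0 t)
    exact ⟨ξ, h1, by rw [h2]; simp⟩
  choose ξ hξ hξ1 using hx
  have ht1 : Tendsto (fun t : ℝ => t + 1) atTop atTop := tendsto_atTop_add_const_right _ _ tendsto_id
  have hξt : Tendsto ξ atTop atTop :=
    tendsto_atTop_mono (fun t => (hξ t).1.le) tendsto_id
  have hV1 : Tendsto (fun t => V1 (ξ t)) atTop (nhds 0) := by
    simp_rw [hξ1]
    simpa using (hl.comp ht1).sub hl
  have hE : Tendsto (fun t => EE p (L ^ (p - 1)) V V1 (ξ t)) atTop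
      (nhds (GG p (L ^ (p - 1)) l)) := by
    have h1 : Tendsto (fun t => GG p (L ^ (p - 1)) (V (ξ t))) atTop
      (nhds (GG p (L ^ (p - 1)) l)) := (GG_cont h.hp).tendsto.comp (hl.comp hξt)
    have := ((hV1.pow 2).div_const 2).add h1
    simpa [EE] using this
  have ht2 : Tendsto (fun t : ℝ => t - 1) atTop atTop := tendsto_atTop_add_const_right _ _ tendsto_id
  refine tendsto_of_tendsto_of_tendsto_of_le_of_le (hE.comp ht2) hE ?_ ?_
  · intro t
    apply h.mono
    have := (hξ (t - 1)).2
    linarith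
  · intro t
    exact h.mono (hξ t).1.le

lemma lim_V1 (h : Sol p α b L V V1) {l : ℝ} (hl : Tendsto V atTop (nhds l)) :
    Tendsto V1 atTop (nhds 0) := by
  have h1 : Tendsto (fun t => GG p (L ^ (p - 1)) (V t)) atTop
      (nhds (GG p (L ^ (p - 1)) l)) := (GG_cont h.hp).tendsto.comp hl
  have h2 := ((h.lim_E hl).sub h1).const_mul 2
  have h3 : Tendsto (fun t => V1 t ^ 2) atTop (nhds 0) := by
    refine (by simpa using h2 : Tendsto _ atTop (nhds (0 : ℝ))).congr fun t => ?_
    unfold EE; ring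
  have h4 := h3.sqrt
  simp only [Real.sqrt_sq_eq_abs, Real.sqrt_zero] at h4
  exact (tendsto_zero_iff_abs_tendsto_zero _).2 h4

lemma lim_eq (h : Sol p α b L V V1) {l : ℝ} (hl : Tendsto V atTop (nhds l)) :
    l = 0 ∨ l = L := by
  have hl0 : 0 ≤ l := ge_of_tendsto' hl fun t => (h.pos t).le
  have hx : ∀ t : ℝ, ∃ ξ ∈ Ioo t (t + 1),
      (b + Real.exp (-2 * ξ) / 2) * V1 ξ + α * (α + b) * V ξ - V ξ ^ p = V1 (t + 1) - V1 t := by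
    intro t
    obtain ⟨ξ, h1, h2⟩ := exists_hasDerivAt_eq_slope V1 _ (show t < t + 1 by linarith)
      (fun t _ => (h.d1 t).continuousAt.continuousWithinAt) (fun t _ => h.d1 t)
    exact ⟨ξ, h1, by rw [h2]; simp⟩
  choose ξ hξ hξ1 using hx
  have ht1 : Tendsto (fun t : ℝ => t + 1) atTop atTop := tendsto_atTop_add_const_right _ _ tendsto_id
  have hξt : Tendsto ξ atTop atTop :=
    tendsto_atTop_mono (fun t => (hξ t).1.le) tendsto_id
  have hV1 := h.lim_V1 hl
  have hA : Tendsto (fun t => (b + Real.exp (-2 * ξ t) / 2) * V1 (ξ t)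
      + α * (α + b) * V (ξ t) - V (ξ t) ^ p) atTop (nhds 0) := by
    simp_rw [hξ1]
    simpa using (hV1.comp ht1).sub hV1
  have hexp : Tendsto (fun t : ℝ => Real.exp (-2 * t)) atTop (nhds 0) := by
    apply Real.tendsto_exp_atBot.comp
    exact tendsto_id.const_mul_atTop_of_neg (by norm_num)
  have hB : Tendsto (fun t => (b + Real.exp (-2 * t) / 2) * V1 t
      + α * (α + b) * V t - V t ^ p) atTop (nhds ((b + 0 / 2) * 0 + α * (α + b) * l - l ^ p)) := by
    have hpw : Tendsto (fun t => V t ^ p) atTop (nhds (l ^ p)) :=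
      hl.rpow_const (Or.inr (by linarith [h.hp]))
    exact (((hexp.div_const 2).const_add b |>.mul hV1).add (hl.const_mul _)).sub hpw
  have := tendsto_nhds_unique (hB.comp hξt) hA
  rcases hl0.eq_or_lt with h0 | h0
  · exact Or.inl h0.symm
  · right
    rw [rpow_p0 h0, ← h.hLp] at this
    have h5 : L ^ (p - 1) = l ^ (p - 1) := by
      have : (L ^ (p - 1) - l ^ (p - 1)) * l = 0 := by linarith
      rcases mul_eq_zero.1 this with h | h <;> linarith
    exact ((Real.rpow_left_inj h.hL.le hl0 (by linarith [h.hp])).1 h5).symm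

end Sol

namespace Sol
variable {p α b L : ℝ} {V V1 : ℝ → ℝ}

lemma not_top (h : Sol p α b L V V1) {T : ℝ} (hT : ∀ t ≥ T, 0 ≤ V1 t)
    (hV : Tendsto V atTop atTop) : False := by
  have hp := h.hp
  set C := b + 1 / 2 with hC
  have hC0 : 0 < C := by have := h.hb; positivity
  set A := α * (α + b) with hA
  have hA0 : 0 < A := by rw [hA, ← h.hLp]; exact Real.rpow_pos_of_pos h.hL _
  have hpow : Tendsto (fun t => V t ^ (p - 1)) atTop atTop :=
    (tendsto_rpow_atTop (by linarith : 0 < p - 1)).comp hV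
  -- threshold
  have hev := (hV.eventually_ge_atTop 1).and
    ((hpow.eventually_ge_atTop (A + 1 + C * (C + 1))).and
      ((eventually_ge_atTop (0 : ℝ)).and (eventually_ge_atTop T)))
  obtain ⟨S, hS⟩ := eventually_atTop.1 hev
  have hc : ∀ t ≥ S, (b + Real.exp (-2 * t) / 2) * V1 t ≤ C * V1 t := by
    intro t ht
    obtain ⟨_, _, h0, h1⟩ := hS t ht
    have : Real.exp (-2 * t) ≤ 1 := Real.exp_le_one_iff.2 (by linarith)
    exact mul_le_mul_of_nonneg_right (by rw [hC]; linarith) (hT t h1)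
  have hanti : AntitoneOn (fun t => V1 t - C * V t) (Ici S) := by
    apply antitoneOn_of_deriv_nonpos (convex_Ici S)
      (fun t _ => ((h.d1 t).sub ((h.d0 t).const_mul C)).continuousAt.continuousWithinAt)
      (fun t _ => ((h.d1 t).sub ((h.d0 t).const_mul C)).differentiableAt.differentiableWithinAt)
    intro t ht
    rw [interior_Ici] at ht
    have hd := ((h.d1 t).sub ((h.d0 t).const_mul C)).deriv
    have h1 := hc t (le_of_lt ht)
    obtain ⟨a1, a2, _, _⟩ := hS t (le_of_lt ht)
    have h2 := rpow_p0 (p := p) (h.pos t)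
    have h3 := mul_le_mul_of_nonneg_right a2 (h.pos t).le
    have h4 : 0 < (1 + C * (C + 1)) * V t := by have := h.pos t; positivity
    refine le_of_eq_of_le hd ?_
    rw [h2]
    nlinarith
  set C0 := |V1 S - C * V S| with hC0'
  have hb1 : ∀ t ≥ S, V1 t ≤ C * V t + C0 := by
    intro t ht
    have := hanti (show S ∈ Ici S from le_refl S) (show t ∈ Ici S from ht) ht
    simp only at this
    linarith [le_abs_self (V1 S - C * V S)]
  have hev2 := (hV.eventually_ge_atTop C0).and (eventually_ge_atTop S)
  obtain ⟨S2, hS2⟩ := eventually_atTop.1 hev2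
  have hanti2 : AntitoneOn (fun t => V1 t + t) (Ici S2) := by
    apply antitoneOn_of_deriv_nonpos (convex_Ici S2)
      (fun t _ => ((h.d1 t).add (hasDerivAt_id t)).continuousAt.continuousWithinAt)
      (fun t _ => ((h.d1 t).add (hasDerivAt_id t)).differentiableAt.differentiableWithinAt)
    intro t ht
    rw [interior_Ici] at ht
    have hd := ((h.d1 t).add (hasDerivAt_id t)).deriv
    obtain ⟨b1, b2⟩ := hS2 t (le_of_lt ht)
    have h1 := hc t b2
    obtain ⟨a1, a2, _, _⟩ := hS t b2
    have h2 := rpow_p0 (p := p) (h.pos t)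
    have h3 := mul_le_mul_of_nonneg_right a2 (h.pos t).le
    have h4 : C * V1 t ≤ C * ((C + 1) * V t) := by
      apply mul_le_mul_of_nonneg_left _ hC0.le
      linarith [hb1 t b2]
    refine le_of_eq_of_le hd ?_
    rw [h2]
    nlinarith
  have hs2 := (hS2 S2 le_rfl).2
  have hST := (hS S2 hs2).2.2.2
  have hp1 := hT S2 hST
  have key := hanti2 (show S2 ∈ Ici S2 from le_refl S2)
    (show S2 + V1 S2 + 1 ∈ Ici S2 from by simp only [mem_Ici]; linarith) (by linarith)
  simp only at key
  have := hT (S2 + V1 S2 + 1) (by linarith)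
  linarith

lemma zero_bdd (h : Sol p α b L V V1) {T : ℝ} (hT : ∀ t ≥ T, V1 t ≤ 0)
    (hV : Tendsto V atTop (nhds 0)) : ∃ B, ∀ t > 0, Real.exp (α * t) * V t ≤ B := by
  have hp := h.hp
  have ha := h.ha
  have hb := h.hb
  have hanti := h.anti_of_le hT
  have hV1 := h.lim_V1 hV
  have hG0 : GG p (L ^ (p - 1)) 0 = 0 := by
    unfold GG; rw [Real.zero_rpow (by linarith)]; simp
  have hE0 : ∀ t, EE p (L ^ (p - 1)) V V1 t ≤ 0 := fun t => by
    have := h.mono.ge_of_tendsto (h.lim_E hV) t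
    rwa [hG0] at this
  set m := α + b with hm
  have hm0 : 0 < m := by positivity
  have hV1b : ∀ t, -(m * V t) ≤ V1 t := by
    intro t
    have h1 := hE0 t
    unfold EE GG at h1
    have h2 : 0 ≤ V t ^ (p + 1) / (p + 1) := by
      have := Real.rpow_pos_of_pos (h.pos t) (p + 1); positivity
    rw [h.hLp] at h1
    have h3 : α * m ≤ m * m := mul_le_mul_of_nonneg_right (by linarith) hm0.le
    have h4 : V1 t ^ 2 ≤ (m * V t) ^ 2 := by
      nlinarith [mul_le_mul_of_nonneg_right h3 (sq_nonneg (V t))]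
    exact (abs_le.1 (abs_le_of_sq_le_sq h4 (mul_pos hm0 (h.pos t)).le)).1
  set ε : ℝ → ℝ := fun t => m * (Real.exp (-2 * t) / 2) + V t ^ (p - 1) with hε
  have hεpos : ∀ t, 0 < ε t := fun t => by
    have := Real.rpow_pos_of_pos (h.pos t) (p - 1)
    simp only [hε]; positivity
  have hεanti : ∀ s ≥ T, ∀ t ≥ s, ε t ≤ ε s := by
    intro s hs t ht
    simp only [hε]
    have h1 : Real.exp (-2 * t) ≤ Real.exp (-2 * s) := Real.exp_le_exp.2 (by linarith)
    have h2 := hanti (show s ∈ Ici T from hs) (show t ∈ Ici T from le_trans hs ht) ht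
    have h3 := Real.rpow_le_rpow (h.pos t).le h2 (show 0 ≤ p - 1 by linarith)
    gcongr
  -- key bound
  have key : ∀ s ≥ T, V1 s + α * V s ≤ ε s * V s / m := by
    intro s hs
    set M := ε s * V s / m with hM
    have hd : ∀ t, HasDerivAt (fun t => Real.exp (-m * t) * (V1 t + α * V t - M))
        (Real.exp (-m * t) * (Real.exp (-2 * t) / 2 * V1 t - V t ^ p + m * M)) t := by
      intro t
      have h1 : HasDerivAt (fun t : ℝ => Real.exp (-m * t)) (Real.exp (-m * t) * (-m * 1)) t :=
        ((hasDerivAt_id t).const_mul (-m)).exp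
      have h2 := ((h.d1 t).add ((h.d0 t).const_mul α)).sub_const M
      refine (h1.mul h2).congr_deriv ?_
      simp only [Pi.add_apply]
      rw [hm]; ring
    have hmono : MonotoneOn (fun t => Real.exp (-m * t) * (V1 t + α * V t - M)) (Ici s) := by
      apply monotoneOn_of_deriv_nonneg (convex_Ici s)
        (fun t _ => (hd t).continuousAt.continuousWithinAt)
        (fun t _ => (hd t).differentiableAt.differentiableWithinAt)
      intro t ht
      rw [interior_Ici] at ht
      have ht' : s ≤ t := le_of_lt ht
      rw [(hd t).deriv]
      apply mul_nonneg (Real.exp_pos _).le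
      have h1 : m * M = ε s * V s := by rw [hM]; field_simp
      rw [h1, rpow_p0 (h.pos t)]
      have h2 := hanti (show s ∈ Ici T from hs) (show t ∈ Ici T from le_trans hs ht') ht'
      have h3 : ε t * V t ≤ ε s * V s :=
        mul_le_mul (hεanti s hs t ht') h2 (h.pos t).le (hεpos s).le
      have h4 : Real.exp (-2 * t) / 2 * (-(m * V t)) ≤ Real.exp (-2 * t) / 2 * V1 t :=
        mul_le_mul_of_nonneg_left (hV1b t) (by positivity)
      have h5 : ε t * V t = m * (Real.exp (-2 * t) / 2) * V t + V t ^ (p - 1) * V t := by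
        simp only [hε]; ring
      linarith
    have hexp : Tendsto (fun t : ℝ => Real.exp (-m * t)) atTop (nhds 0) := by
      apply Real.tendsto_exp_atBot.comp
      exact tendsto_id.const_mul_atTop_of_neg (by linarith)
    have hlim : Tendsto (fun t => Real.exp (-m * t) * (V1 t + α * V t - M)) atTop (nhds 0) := by
      have := hexp.mul ((hV1.add (hV.const_mul α)).sub_const M)
      simpa using this
    have hle : Real.exp (-m * s) * (V1 s + α * V s - M) ≤ 0 := by
      apply ge_of_tendsto hlim
      filter_upwards [eventually_ge_atTop s] with t ht
      exact hmono (show s ∈ Ici s from le_refl s) (show t ∈ Ici s from ht) ht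
    by_contra hcon
    push Not at hcon
    have := mul_pos (Real.exp_pos (-m * s)) (sub_pos.2 hcon)
    linarith
  -- eps to 0
  have hεlim : Tendsto ε atTop (nhds 0) := by
    have hexp : Tendsto (fun t : ℝ => Real.exp (-2 * t)) atTop (nhds 0) := by
      apply Real.tendsto_exp_atBot.comp
      exact tendsto_id.const_mul_atTop_of_neg (by norm_num)
    have hpw : Tendsto (fun t => V t ^ (p - 1)) atTop (nhds 0) := by
      have := hV.rpow_const (p := p - 1) (Or.inr (by linarith))
      rwa [Real.zero_rpow (by linarith)] at this
    have := ((hexp.div_const 2).const_mul m).add hpw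
    rwa [zero_div, mul_zero, add_zero] at this
  obtain ⟨S, hS⟩ := eventually_atTop.1 ((hεlim.eventually_le_const
    (show 0 < m * (α / 2) by positivity)).and
    ((eventually_ge_atTop T).and (eventually_ge_atTop (0 : ℝ))))
  have hS0 := (hS S le_rfl).2.2
  -- first decay
  have hd : ∀ a t, HasDerivAt (fun t => Real.exp (a * t) * V t)
      (Real.exp (a * t) * (V1 t + a * V t)) t := by
    intro a t
    have h1 : HasDerivAt (fun t : ℝ => Real.exp (a * t)) (Real.exp (a * t) * (a * 1)) t :=
      ((hasDerivAt_id t).const_mul a).exp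
    refine (h1.mul (h.d0 t)).congr_deriv ?_
    ring
  have hdec : AntitoneOn (fun t => Real.exp (α / 2 * t) * V t) (Ici S) := by
    apply antitoneOn_of_deriv_nonpos (convex_Ici S)
      (fun t _ => (hd _ t).continuousAt.continuousWithinAt)
      (fun t _ => (hd _ t).differentiableAt.differentiableWithinAt)
    intro t ht
    rw [interior_Ici] at ht
    obtain ⟨a1, a2, a3⟩ := hS t (le_of_lt ht)
    rw [(hd _ t).deriv]
    apply mul_nonpos_of_nonneg_of_nonpos (Real.exp_pos _).le
    have h1 := key t a2
    have h2 : ε t * V t / m ≤ α / 2 * V t := by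
      rw [div_le_iff₀ hm0]
      nlinarith [mul_le_mul_of_nonneg_right a1 (h.pos t).le]
    linarith
  set D := Real.exp (α / 2 * S) * V S with hD
  have hDpos : 0 < D := mul_pos (Real.exp_pos _) (h.pos S)
  set C := (m / 2 + D ^ (p - 1)) / m with hC
  have hεC : ∀ t ≥ S, ε t / m ≤ C * Real.exp (-t) := by
    intro t ht
    have ht0 := (hS t ht).2.2
    have h1 : Real.exp (α / 2 * t) * V t ≤ D :=
      hdec (show S ∈ Ici S from le_refl S) (show t ∈ Ici S from ht) ht
    have h2 := Real.rpow_le_rpow (mul_pos (Real.exp_pos _) (h.pos t)).le h1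
      (show 0 ≤ p - 1 by linarith)
    rw [Real.mul_rpow (Real.exp_pos _).le (h.pos t).le, ← Real.exp_mul] at h2
    have h3 : α / 2 * t * (p - 1) = t := by
      have := h.hap
      linear_combination (t / 2) * this
    rw [h3] at h2
    have h4 : V t ^ (p - 1) ≤ D ^ (p - 1) * Real.exp (-t) := by
      rw [Real.exp_neg, ← div_eq_mul_inv, le_div_iff₀ (Real.exp_pos _)]
      linarith
    have h5 : Real.exp (-2 * t) ≤ Real.exp (-t) := Real.exp_le_exp.2 (by linarith)
    rw [hC, div_mul_eq_mul_div]
    apply div_le_div_of_nonneg_right _ hm0.le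
    simp only [hε]
    nlinarith
  -- final
  have hd2 : ∀ t, HasDerivAt (fun t => Real.exp (C * Real.exp (-t)) * (Real.exp (α * t) * V t))
      (Real.exp (C * Real.exp (-t)) * (Real.exp (α * t) *
        (V1 t + α * V t - C * Real.exp (-t) * V t))) t := by
    intro t
    have h1 : HasDerivAt (fun t : ℝ => Real.exp (-t)) (Real.exp (-t) * (-1)) t :=
      (hasDerivAt_id t).neg.exp
    refine ((h1.const_mul C).exp.mul (hd α t)).congr_deriv ?_
    ring
  have hdec2 : AntitoneOn (fun t => Real.exp (C * Real.exp (-t)) * (Real.exp (α * t) * V t))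
      (Ici S) := by
    apply antitoneOn_of_deriv_nonpos (convex_Ici S)
      (fun t _ => (hd2 t).continuousAt.continuousWithinAt)
      (fun t _ => (hd2 t).differentiableAt.differentiableWithinAt)
    intro t ht
    rw [interior_Ici] at ht
    obtain ⟨a1, a2, a3⟩ := hS t (le_of_lt ht)
    rw [(hd2 t).deriv]
    apply mul_nonpos_of_nonneg_of_nonpos (Real.exp_pos _).le
    apply mul_nonpos_of_nonneg_of_nonpos (Real.exp_pos _).le
    have h1 := key t a2
    have h2 := mul_le_mul_of_nonneg_right (hεC t (le_of_lt ht)) (h.pos t).le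
    rw [div_mul_eq_mul_div] at h2
    linarith
  have hcont : ContinuousOn (fun t => Real.exp (α * t) * V t) (Icc 0 S) :=
    fun t _ => (hd α t).continuousAt.continuousWithinAt
  obtain ⟨B0, hB0⟩ := (isCompact_Icc.image_of_continuousOn hcont).bddAbove
  refine ⟨max B0 (Real.exp (C * Real.exp (-S)) * (Real.exp (α * S) * V S)), fun t ht => ?_⟩
  rcases le_total t S with hc | hc
  · exact le_trans (hB0 (mem_image_of_mem _ ⟨ht.le, hc⟩)) (le_max_left _ _)
  · refine le_trans ?_ (le_max_right _ _)
    refine le_trans ?_ (hdec2 (show S ∈ Ici S from le_refl S) (show t ∈ Ici S from hc) hc)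
    have hC0 : 0 < C := by positivity
    have : 1 ≤ Real.exp (C * Real.exp (-t)) := Real.one_le_exp (by positivity)
    have h3 := mul_pos (Real.exp_pos (α * t)) (h.pos t)
    simp only
    nlinarith

lemma of_sign (h : Sol p α b L V V1)
    (hun : ¬ ∃ B, ∀ t > 0, Real.exp (α * t) * V t ≤ B)
    {T : ℝ} (hT : (∀ t ≥ T, V1 t ≤ 0) ∨ (∀ t ≥ T, 0 ≤ V1 t)) (t : ℝ) : V t = L := by
  have hfin : ∀ l, Tendsto V atTop (nhds l) → V t = L := by
    intro l hl
    rcases h.lim_eq hl with h0 | h0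
    · subst h0
      rcases hT with hT | hT
      · exact absurd (h.zero_bdd hT hl) hun
      · have := h.mono_of_ge hT
        have h2 : V T ≤ 0 := by
          apply ge_of_tendsto hl
          filter_upwards [eventually_ge_atTop T] with s hs
          exact this (show T ∈ Ici T from le_refl T) (show s ∈ Ici T from hs) hs
        exact absurd (h.pos T) (not_lt.2 h2)
    · subst h0
      exact h.finish (h.lim_E hl) t
  -- modified function W s = V (max s T)
  have heq : ∀ᶠ s in atTop, V (max s T) = V s := by
    filter_upwards [eventually_ge_atTop T] with s hs
    rw [max_eq_left hs]
  rcases hT with hT | hT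
  · have hm := h.anti_of_le hT
    have hW : Antitone (fun s => V (max s T)) := fun a c hac =>
      hm (show T ≤ max a T from le_max_right _ _) (show T ≤ max c T from le_max_right _ _)
        (max_le_max_right _ hac)
    have hbdd : BddBelow (range fun s => V (max s T)) :=
      ⟨0, by rintro _ ⟨s, rfl⟩; exact (h.pos _).le⟩
    exact hfin _ ((tendsto_atTop_ciInf hW hbdd).congr' heq)
  · have hm := h.mono_of_ge hT
    have hW : Monotone (fun s => V (max s T)) := fun a c hac =>
      hm (show T ≤ max a T from le_max_right _ _) (show T ≤ max c T from le_max_right _ _)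
        (max_le_max_right _ hac)
    rcases tendsto_atTop_of_monotone hW with h1 | ⟨l, h1⟩
    · exact (h.not_top hT (h1.congr' heq)).elim
    · exact hfin _ (h1.congr' heq)

/-- oscillation with damping -/
lemma osc (h : Sol p α b L V V1) (hb : 0 < b)
    (h1 : ∀ T, ∃ t ≥ T, L < V t) (h2 : ∀ T, ∃ t ≥ T, V t < L) (t : ℝ) : V t = L := by
  have hp := h.hp
  have hcont : Continuous V := continuous_iff_continuousAt.2 fun t => (h.d0 t).continuousAt
  set A := L ^ (p - 1) with hA
  have hA0 : 0 < A := Real.rpow_pos_of_pos h.hL _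
  have hE0 : ∀ t, EE p A V V1 t ≤ 0 := by
    intro T
    obtain ⟨s1, hs1, hv1⟩ := h1 T
    obtain ⟨s2, hs2, hv2⟩ := h2 s1
    obtain ⟨s3, hs3, hv3⟩ := h1 s2
    obtain ⟨x, hx, hmin⟩ := isCompact_Icc.exists_isMinOn (s := Icc s1 s3)
      ⟨s2, hs2, hs3⟩ hcont.continuousOn
    have hxL : V x < L := lt_of_le_of_lt (hmin ⟨hs2, hs3⟩) hv2
    have hx1 : s1 < x := lt_of_le_of_ne hx.1 (by rintro rfl; linarith)
    have hx3 : x < s3 := lt_of_le_of_ne hx.2 (by rintro rfl; linarith)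
    have hloc : IsLocalMin V x := hmin.isLocalMin (Icc_mem_nhds hx1 hx3)
    have hV1 : V1 x = 0 := hloc.hasDerivAt_eq_zero (h.d0 x)
    refine le_trans (h.mono (show T ≤ x by linarith)) ?_
    unfold EE
    rw [hV1]
    have := GG_neg hp h.hL (h.pos x) hxL.le
    simp only [← hA] at this ⊢
    linarith
  -- bounds
  obtain ⟨K0, hK0⟩ : ∃ K0, ∀ t, V t ≤ K0 := by
    refine ⟨((p + 1) / 2 * A) ^ (p - 1)⁻¹, fun t => ?_⟩
    have h3 := hE0 t
    unfold EE GG at h3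
    rw [rpow_p1 (h.pos t)] at h3
    have h4 : V t ^ (p - 1) * V t ^ 2 / (p + 1) ≤ A * V t ^ 2 / 2 := by
      nlinarith [sq_nonneg (V1 t)]
    rw [div_le_div_iff₀ (by linarith) (by norm_num)] at h4
    have h5 : V t ^ (p - 1) ≤ (p + 1) / 2 * A := by
      have : 0 < V t ^ 2 := pow_pos (h.pos t) 2
      by_contra hcon
      push Not at hcon
      nlinarith [mul_lt_mul_of_pos_right hcon this]
    rwa [Real.le_rpow_inv_iff_of_pos (h.pos t).le (by positivity) (by linarith)]
  have hK0p : 0 < K0 := lt_of_lt_of_le (h.pos 0) (hK0 0)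
  have hV1b : ∀ t, |V1 t| ≤ (A + 1) * K0 := by
    intro t
    have h3 := hE0 t
    unfold EE GG at h3
    have h4 : 0 ≤ V t ^ (p + 1) / (p + 1) := by
      have := Real.rpow_pos_of_pos (h.pos t) (p + 1); positivity
    apply abs_le_of_sq_le_sq _ (by positivity)
    have h5 : V t ^ 2 ≤ K0 ^ 2 := pow_le_pow_left₀ (h.pos t).le (hK0 t) 2
    have h6 : 0 < K0 ^ 2 := by positivity
    have : V1 t ^ 2 ≤ A * K0 ^ 2 := by nlinarith [mul_le_mul_of_nonneg_left h5 hA0.le]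
    nlinarith
  set K := (b + 1 / 2) * ((A + 1) * K0) + A * K0 + K0 ^ p + 1 with hK
  have hK0pp : 0 < K0 ^ p := Real.rpow_pos_of_pos hK0p _
  have hKp : 0 < K := by positivity
  have hK2 : ∀ t ≥ 0, |(b + Real.exp (-2 * t) / 2) * V1 t + α * (α + b) * V t - V t ^ p| ≤ K := by
    intro t ht
    rw [← h.hLp, ← hA]
    have e1 : Real.exp (-2 * t) ≤ 1 := Real.exp_le_one_iff.2 (by linarith)
    have e2 : |(b + Real.exp (-2 * t) / 2) * V1 t| ≤ (b + 1 / 2) * ((A + 1) * K0) := by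
      rw [abs_mul, abs_of_nonneg (by positivity)]
      exact mul_le_mul (by linarith) (hV1b t) (abs_nonneg _) (by positivity)
    have e3 : V t ^ p ≤ K0 ^ p := Real.rpow_le_rpow (h.pos t).le (hK0 t) (by linarith)
    have e4 : 0 < V t ^ p := Real.rpow_pos_of_pos (h.pos t) _
    have e5 : A * V t ≤ A * K0 := mul_le_mul_of_nonneg_left (hK0 t) hA0.le
    have e6 : 0 < A * V t := mul_pos hA0 (h.pos t)
    rw [abs_le] at e2 ⊢
    constructor <;> linarith [e2.1, e2.2]
  -- suppose V t ≠ L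
  by_contra hne
  have hgap : GG p A L < EE p A V V1 t := by
    have := GG_min hp h.hL (h.pos t) hne
    unfold EE
    nlinarith [sq_nonneg (V1 t)]
  set η := Real.sqrt (2 * (EE p A V V1 t - GG p A L)) with hη
  have hηp : 0 < η := Real.sqrt_pos.2 (by linarith)
  have hη2 : η ^ 2 = 2 * (EE p A V V1 t - GG p A L) := Real.sq_sqrt (by linarith)
  set d := η / (2 * K) with hd
  have hdp : 0 < d := by positivity
  -- E converges
  have hbdd : BddAbove (range (EE p A V V1)) := ⟨0, by rintro _ ⟨s, rfl⟩; exact hE0 s⟩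
  have hlim := tendsto_atTop_ciSup h.mono hbdd
  have htd : Tendsto (fun t : ℝ => t + d) atTop atTop :=
    tendsto_atTop_add_const_right _ _ tendsto_id
  have hdiff : Tendsto (fun s => EE p A V V1 (s + d) - EE p A V V1 s) atTop (nhds 0) := by
    simpa using (hlim.comp htd).sub hlim
  have hpos : 0 < d * (b * (η / 2) ^ 2) := by positivity
  obtain ⟨S, hS⟩ := eventually_atTop.1 (hdiff.eventually_lt_const hpos)
  obtain ⟨s1, hs1, hv1⟩ := h1 (max S (max 0 t))
  obtain ⟨s2, hs2, hv2⟩ := h2 s1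
  obtain ⟨x, hx, hxL⟩ := intermediate_value_Icc' hs2 hcont.continuousOn
    (show L ∈ Icc (V s2) (V s1) from ⟨hv2.le, hv1.le⟩)
  have hxS : S ≤ x := le_trans (le_trans (le_max_left _ _) hs1) hx.1
  have hx0 : 0 ≤ x := le_trans (le_trans (le_trans (le_max_left _ _) (le_max_right _ _)) hs1) hx.1
  have hxt : t ≤ x := le_trans (le_trans (le_trans (le_max_right _ _) (le_max_right _ _)) hs1) hx.1
  have hxV : η ≤ |V1 x| := by
    apply le_abs.2
    have e1 := h.mono hxt
    have e2 : EE p A V V1 x = V1 x ^ 2 / 2 + GG p A L := by unfold EE; rw [hxL]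
    have e3 : η ^ 2 ≤ V1 x ^ 2 := by
      rw [hη2]
      simp only [← hA] at e1
      linarith
    exact le_abs.1 (by simpa [abs_of_pos hηp] using sq_le_sq.1 e3)
  obtain ⟨ξ, hξ, hξ2⟩ := exists_hasDerivAt_eq_slope (EE p A V V1) _ (show x < x + d by linarith)
      (fun t _ => (h.dE t).continuousAt.continuousWithinAt) (fun t _ => h.dE t)
  have hV1ξ : η / 2 ≤ |V1 ξ| := by
    have hb2 : ‖V1 ξ - V1 x‖ ≤ K * ‖ξ - x‖ := by
      apply Convex.norm_image_sub_le_of_norm_hasDerivWithin_le (s := Ici (0:ℝ))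
        (fun y _ => (h.d1 y).hasDerivWithinAt) (fun y hy => ?_) (convex_Ici 0)
        (show x ∈ Ici (0:ℝ) from hx0) (show ξ ∈ Ici (0:ℝ) from le_trans hx0 hξ.1.le)
      exact hK2 y hy
    rw [Real.norm_eq_abs, Real.norm_eq_abs, abs_of_pos (sub_pos.2 hξ.1)] at hb2
    have e1 : K * (ξ - x) ≤ K * d := mul_le_mul_of_nonneg_left (by linarith [hξ.2]) hKp.le
    have e2 : K * d = η / 2 := by rw [hd]; field_simp
    have e3 := abs_sub_abs_le_abs_sub (V1 x) (V1 ξ)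
    rw [abs_sub_comm] at e3
    linarith
  have hfinal := hS x hxS
  have e1 : x + d - x = d := by ring
  rw [e1, eq_div_iff hdp.ne'] at hξ2
  rw [← hξ2] at hfinal
  have e2 : (η / 2) ^ 2 ≤ V1 ξ ^ 2 := by
    rw [← sq_abs (V1 ξ)]
    exact pow_le_pow_left₀ (by positivity) hV1ξ 2
  have e3 : b * (η / 2) ^ 2 ≤ (b + Real.exp (-2 * ξ) / 2) * V1 ξ ^ 2 :=
    mul_le_mul (by linarith [Real.exp_pos (-2 * ξ)]) e2 (by positivity) (by positivity)
  nlinarith [mul_le_mul_of_nonneg_left e3 hdp.le]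

lemma core (h : Sol p α b L V V1)
    (hun : ¬ ∃ B, ∀ t > 0, Real.exp (α * t) * V t ≤ B)
    (hs : b = 0 → ¬ ((∀ T, ∃ t ≥ T, L < V t) ∧ (∀ T, ∃ t ≥ T, V t < L))) (t : ℝ) : V t = L := by
  by_cases h1 : ∀ T, ∃ t ≥ T, L < V t
  · by_cases h2 : ∀ T, ∃ t ≥ T, V t < L
    · rcases h.hb.eq_or_lt with hb | hb
      · exact absurd ⟨h1, h2⟩ (hs hb.symm)
      · exact h.osc hb h1 h2 t
    · push Not at h2
      obtain ⟨T, hT⟩ := h2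
      obtain ⟨T', hT'⟩ := h.sign_of_ge hT
      exact h.of_sign hun hT' t
  · push Not at h1
    obtain ⟨T, hT⟩ := h1
    obtain ⟨T', hT'⟩ := h.sign_of_le hT
    exact h.of_sign hun hT' t

end Sol

lemma alt_contra (f : ℝ → ℝ) (h1 : ∀ δ > 0, ∃ r, 0 < r ∧ r < δ ∧ 0 < f r)
    (h2 : ∀ δ > 0, ∃ r, 0 < r ∧ r < δ ∧ f r < 0) (N : ℕ)
    (hN : ∀ t : Fin (N + 1) → ℝ, StrictMono t → (∀ i, 0 < t i) →
        ∃ i : Fin N, 0 ≤ f (t i.castSucc) * f (t i.succ)) : False := by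
  have h3 : ∀ (k : ℕ) (δ : ℝ), ∃ r, 0 < δ → 0 < r ∧ r < δ ∧ 0 < (-1) ^ k * f r := by
    intro k δ
    by_cases hδ : 0 < δ
    · rcases Nat.even_or_odd k with hk | hk
      · obtain ⟨r, a, b, c⟩ := h1 δ hδ
        exact ⟨r, fun _ => ⟨a, b, by rw [hk.neg_one_pow]; linarith⟩⟩
      · obtain ⟨r, a, b, c⟩ := h2 δ hδ
        exact ⟨r, fun _ => ⟨a, b, by rw [hk.neg_one_pow]; linarith⟩⟩
    · exact ⟨0, fun h => absurd h hδ⟩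
  choose F hF using h3
  let u : ℕ → ℝ := fun k => Nat.rec (F 0 1) (fun k x => F (k + 1) x) k
  have hu : ∀ k, 0 < u k ∧ 0 < (-1) ^ k * f (u k) := by
    intro k
    induction k with
    | zero =>
      have := hF 0 1 one_pos
      exact ⟨this.1, this.2.2⟩
    | succ k ih =>
      have := hF (k + 1) (u k) ih.1
      exact ⟨this.1, this.2.2⟩
  have hus : ∀ k, u (k + 1) < u k := fun k => (hF (k + 1) (u k) (hu k).1).2.1
  have hanti : StrictAnti u := strictAnti_nat_of_succ_lt hus
  obtain ⟨i, hi⟩ := hN (fun i => u (N - i)) (by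
    intro i j hij
    apply hanti
    have := i.2
    have := j.2
    have : (i : ℕ) < j := hij
    omega) (fun i => (hu _).1)
  have hi2 := i.2
  simp only [Fin.val_castSucc, Fin.val_succ] at hi
  have e : N - (i : ℕ) = (N - (i + 1)) + 1 := by omega
  rw [e] at hi
  have a1 := (hu (N - (i + 1) + 1)).2
  have a2 := (hu (N - (i + 1))).2
  have a3 := mul_pos a1 a2
  have a4 : ((-1 : ℝ) ^ (N - (i + 1) + 1) * f (u (N - (i + 1) + 1))) *
      ((-1) ^ (N - (i + 1)) * f (u (N - (i + 1)))) =
      -(((-1 : ℝ) ^ (N - (i + 1))) ^ 2 * (f (u (N - (i + 1) + 1)) * f (u (N - (i + 1))))) := by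
    rw [pow_succ]; ring
  rw [a4, ← pow_mul, mul_comm _ 2, pow_mul] at a3
  norm_num at a3
  linarith

theorem stmt11 (n : ℕ) (hn : 2 < n) (p : ℝ) (hp : ((n : ℝ) + 2) / ((n : ℝ) - 2) ≤ p)
    (α L : ℝ) (hα : α = 2 / (p - 1)) (hL : 0 < L)
    (hLp : L ^ (p - 1) = 2 / (p - 1) ^ 2 * (((n : ℝ) - 2) * p - n))
    (w : ℝ → ℝ) (hpos : ∀ r > 0, 0 < w r)
    (hC2 : ContDiffOn ℝ 2 w (Ioi 0))
    (heq : ∀ r > 0, deriv (deriv w) r + (((n : ℝ) - 1) / r + r / 2) * deriv w r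
      + w r / (p - 1) + w r ^ p = 0)
    (hunbdd : ¬ ∃ B, ∀ r ∈ Ioo (0:ℝ) 1, w r ≤ B)
    (hsign : p = ((n : ℝ) + 2) / ((n : ℝ) - 2) →
      ∃ N : ℕ, ∀ t : Fin (N + 1) → ℝ, StrictMono t → (∀ i, 0 < t i) →
        ∃ i : Fin N,
          0 ≤ (w (t i.castSucc) - L * (t i.castSucc) ^ (-α))
            * (w (t i.succ) - L * (t i.succ) ^ (-α))) :
    ∀ r > (0:ℝ), w r = L * r ^ (-α) := by
  have hn' : (2 : ℝ) < n := by exact_mod_cast hn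
  have hn2 : (0 : ℝ) < n - 2 := by linarith
  have hps : (n : ℝ) + 2 ≤ p * (n - 2) := (div_le_iff₀ hn2).1 hp
  have hp1 : 1 < p := by nlinarith
  have hq : 0 < p - 1 := by linarith
  have ha : 0 < α := by rw [hα]; positivity
  have hap : α * (p - 1) = 2 := by rw [hα]; field_simp
  have hinv : 1 / (p - 1) = α / 2 := by rw [hα]; field_simp
  set b : ℝ := (n : ℝ) - 2 - 2 * α with hb
  have hbe : b * (p - 1) = p * (n - 2) - (n + 2) := by rw [hb]; linear_combination (-2) * hap
  have hb0 : 0 ≤ b := by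
    by_contra hcon
    push Not at hcon
    nlinarith [mul_neg_of_neg_of_pos hcon hq]
  have hLp' : L ^ (p - 1) = α * (α + b) := by
    rw [hLp, hb, hα]; field_simp; ring
  have hwd : ∀ r > 0, HasDerivAt w (deriv w r) r := fun r hr =>
    ((hC2.contDiffAt (Ioi_mem_nhds hr)).differentiableAt (by norm_num)).hasDerivAt
  have hwd2 : ∀ r > 0, HasDerivAt (deriv w) (deriv (deriv w) r) r := fun r hr =>
    by
      have h1 : ContDiffOn ℝ 1 (deriv w) (Ioi 0) :=
        hC2.deriv_of_isOpen isOpen_Ioi (by norm_num)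
      exact ((h1.contDiffAt (Ioi_mem_nhds hr)).differentiableAt (by norm_num)).hasDerivAt
  set V : ℝ → ℝ := fun t => Real.exp (-α * t) * w (Real.exp (-t)) with hV
  set V1 : ℝ → ℝ := fun t => -α * V t -
    Real.exp (-α * t) * (Real.exp (-t) * deriv w (Real.exp (-t))) with hV1
  have he1 : ∀ t, HasDerivAt (fun t : ℝ => Real.exp (-t)) (-Real.exp (-t)) t := fun t =>
    ((hasDerivAt_id t).neg.exp).congr_deriv (by simp)
  have he2 : ∀ t, HasDerivAt (fun t : ℝ => Real.exp (-α * t)) (-α * Real.exp (-α * t)) t := fun t =>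
    (((hasDerivAt_id t).const_mul (-α)).exp).congr_deriv (by simp; ring)
  have hd0 : ∀ t, HasDerivAt V (V1 t) t := by
    intro t
    have h1 := (hwd _ (Real.exp_pos (-t))).comp t (he1 t)
    refine ((he2 t).mul h1).congr_deriv ?_
    simp only [hV1, hV, Function.comp]
    ring
  have hsol : Sol p α b L V V1 := by
    refine ⟨hp1, ha, hb0, hap, hL, hLp', fun t => mul_pos (Real.exp_pos _) (hpos _ (Real.exp_pos _)),
      hd0, fun t => ?_⟩
    have h1 := (hwd2 _ (Real.exp_pos (-t))).comp t (he1 t)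
    have h2 := ((hd0 t).const_mul (-α)).sub ((he2 t).mul ((he1 t).mul h1))
    refine h2.congr_deriv ?_
    have hr := Real.exp_pos (-t)
    have h3 := heq _ hr
    have h4 : V t ^ p = Real.exp (-α * t) * Real.exp (-t) ^ 2 * w (Real.exp (-t)) ^ p := by
      simp only [hV]
      rw [Real.mul_rpow (Real.exp_pos _).le (hpos _ hr).le, ← Real.exp_mul, ← Real.exp_nat_mul,
        ← Real.exp_add]
      congr 2
      push_cast
      linear_combination (-t) * hap
    have h5 : Real.exp (-2 * t) = Real.exp (-t) ^ 2 := by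
      rw [← Real.exp_nat_mul]; congr 1; push_cast; ring
    rw [h4, h5]
    simp only [hV1, hV, Function.comp, Pi.mul_apply]
    rw [div_eq_mul_one_div (w _), hinv] at h3
    generalize Real.exp (-t) = r at *
    generalize Real.exp (-α * t) = q at *
    have h6 : deriv (deriv w) r = -((((n : ℝ) - 1) / r + r / 2) * deriv w r
      + w r * (α / 2) + w r ^ p) := by linarith
    rw [h6, hb]
    field_simp
    ring
  have hexpV : ∀ r > 0, V (-Real.log r) = r ^ α * w r := by
    intro r hr
    simp only [hV]
    rw [neg_neg, Real.exp_log hr, Real.rpow_def_of_pos hr]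
    congr 2; ring
  have hun : ¬ ∃ B, ∀ t > 0, Real.exp (α * t) * V t ≤ B := by
    rintro ⟨B, hB⟩
    refine hunbdd ⟨B, fun r hr => ?_⟩
    have h1 := hB (-Real.log r) (by have := Real.log_neg hr.1 hr.2; linarith)
    rw [hexpV r hr.1, Real.rpow_def_of_pos hr.1, ← mul_assoc, ← Real.exp_add] at h1
    have e : α * -Real.log r + Real.log r * α = 0 := by ring
    rwa [e, Real.exp_zero, one_mul] at h1
  have hrel : ∀ r > 0, w r - L * r ^ (-α) = r ^ (-α) * (V (-Real.log r) - L) := by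
    intro r hr
    rw [hexpV r hr, mul_sub, ← mul_assoc, ← Real.rpow_add hr]
    simp; ring
  have hs : b = 0 → ¬ ((∀ T, ∃ t ≥ T, L < V t) ∧ (∀ T, ∃ t ≥ T, V t < L)) := by
    rintro hb' ⟨h1, h2⟩
    have hpe : p = ((n : ℝ) + 2) / ((n : ℝ) - 2) := by
      rw [eq_div_iff hn2.ne']
      rw [hb'] at hbe
      linarith
    obtain ⟨N, hN⟩ := hsign hpe
    have hlt : ∀ δ > 0, ∀ t ≥ -Real.log δ + 1, Real.exp (-t) < δ := by
      intro δ hδ t ht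
      rw [← Real.lt_log_iff_exp_lt hδ]
      linarith
    refine alt_contra (fun r => w r - L * r ^ (-α)) ?_ ?_ N hN
    · intro δ hδ
      obtain ⟨t, ht, htL⟩ := h1 (-Real.log δ + 1)
      refine ⟨Real.exp (-t), Real.exp_pos _, hlt δ hδ t ht, ?_⟩
      rw [hrel _ (Real.exp_pos _), Real.log_exp, neg_neg]
      exact mul_pos (Real.rpow_pos_of_pos (Real.exp_pos _) _) (by linarith)
    · intro δ hδ
      obtain ⟨t, ht, htL⟩ := h2 (-Real.log δ + 1)
      refine ⟨Real.exp (-t), Real.exp_pos _, hlt δ hδ t ht, ?_⟩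
      rw [hrel _ (Real.exp_pos _), Real.log_exp, neg_neg]
      exact mul_neg_of_pos_of_neg (Real.rpow_pos_of_pos (Real.exp_pos _) _) (by linarith)
  intro r hr
  have h1 := hrel r hr
  rw [hsol.core hun hs] at h1
  linarith
end

section
/- Let n > 2, p ≥ (n+2)/(n-2), and let w be a positive unbounded C² solution of w'' + ((n-1)/r - r/2) w' - w/(p-1) + w^p = 0 on (0,∞); if p = (n+2)/(n-2), assume additionally that w(r) - L r^{-2/(p-1)} changes sign only finitely many times. Then w(r) = L r^{-2/(p-1)} for all r > 0. -/
open Set Filter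

/-- backward linear drift -/
theorem drift {g g' : ℝ → ℝ} {T c : ℝ} (hd : ∀ t ≤ T, HasDerivAt g (g' t) t)
    (h : ∀ t ≤ T, g' t ≤ -c) : ∀ t ≤ T, g T + c * (T - t) ≤ g t := by
  intro t ht
  have hanti : AntitoneOn (fun x => g x + c * x) (Iic T) := by
    apply antitoneOn_of_hasDerivWithinAt_nonpos (f' := fun x => g' x + c * 1) (convex_Iic T)
    · intro x hx
      exact ((hd x hx).add ((hasDerivAt_id x).const_mul c)).continuousAt.continuousWithinAt
    · intro x hx
      rw [interior_Iic] at hx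
      exact ((hd x hx.le).add ((hasDerivAt_id x).const_mul c)).hasDerivWithinAt
    · intro x hx
      rw [interior_Iic] at hx
      have := h x hx.le
      linarith
  have := hanti (show t ∈ Iic T from ht) (show T ∈ Iic T from le_refl T) ht
  simp only at this
  linarith

theorem drift_false {g g' : ℝ → ℝ} {T c B : ℝ} (hd : ∀ t ≤ T, HasDerivAt g (g' t) t)
    (h : ∀ t ≤ T, g' t ≤ -c) (hc : 0 < c) (hB : ∀ t ≤ T, g t ≤ B) : False := by
  have h1 := drift hd h
  have hBT := hB T le_rfl
  have hq : 0 ≤ (B - g T + 1) / c := by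
    apply div_nonneg <;> linarith
  have h2 := h1 (T - (B - g T + 1) / c) (by linarith)
  have h3 := hB (T - (B - g T + 1) / c) (by linarith)
  have h4 : c * (T - (T - (B - g T + 1) / c)) = B - g T + 1 := by
    field_simp
    ring
  linarith

theorem back_growth {g g' : ℝ → ℝ} {T B : ℝ} (hd : ∀ t ≤ T, HasDerivAt g (g' t) t)
    (hB : ∀ t ≤ T, g t ≤ B)
    (h : ∀ η > 0, ∃ c > 0, ∀ t ≤ T, η < g t → g' t ≤ -c) : ∀ t ≤ T, g t ≤ 0 := by
  intro t1 ht1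
  by_contra hpos
  push Not at hpos
  obtain ⟨c, hc, hcg⟩ := h (g t1 / 2) (by linarith)
  have hall : ∀ t ≤ t1, g t1 / 2 < g t := by
    intro t ht
    by_contra hcon
    push Not at hcon
    have hcont : ContinuousOn g (Icc t t1) := fun x hx =>
      (hd x (hx.2.trans ht1)).continuousAt.continuousWithinAt
    have hcl : IsCompact (Icc t t1 ∩ g ⁻¹' (Iic (g t1 / 2))) := by
      apply IsCompact.of_isClosed_subset isCompact_Icc _ inter_subset_left
      exact hcont.preimage_isClosed_of_isClosed isClosed_Icc isClosed_Iic
    obtain ⟨s, ⟨hs1, hs2⟩, hs3⟩ := hcl.exists_isGreatest ⟨t, ⟨le_rfl, ht⟩, hcon⟩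
    have hs2' : g s ≤ g t1 / 2 := hs2
    have hanti : AntitoneOn g (Icc s t1) := by
      apply antitoneOn_of_hasDerivWithinAt_nonpos (f' := g') (convex_Icc s t1)
      · intro x hx
        exact (hd x (hx.2.trans ht1)).continuousAt.continuousWithinAt
      · intro x hx
        rw [interior_Icc] at hx
        exact (hd x (hx.2.le.trans ht1)).hasDerivWithinAt
      · intro x hx
        rw [interior_Icc] at hx
        have : g t1 / 2 < g x := by
          by_contra hx'
          push Not at hx'
          have := hs3 (show x ∈ Icc t t1 ∩ g ⁻¹' (Iic (g t1 / 2)) from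
            ⟨⟨hs1.1.trans hx.1.le, hx.2.le⟩, hx'⟩)
          linarith [hx.1]
        have := hcg x (hx.2.le.trans ht1) this
        linarith
    have := hanti (show s ∈ Icc s t1 from ⟨le_rfl, hs1.2⟩)
      (show t1 ∈ Icc s t1 from ⟨hs1.2, le_rfl⟩) hs1.2
    linarith
  exact drift_false (fun t ht => hd t (ht.trans ht1))
    (fun t ht => hcg t (ht.trans ht1) (hall t ht)) hc (fun t ht => hB t (ht.trans ht1))

theorem exp2_deriv (t : ℝ) : HasDerivAt (fun x : ℝ => Real.exp (2 * x)) (2 * Real.exp (2 * t)) t := by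
  have := ((hasDerivAt_id t).const_mul 2).exp
  refine HasDerivAt.congr_deriv (this) ?_
  simp only [id]
  ring

theorem sign_lemma {Y Y1 r : ℝ → ℝ} {A T B : ℝ} (hA : 0 ≤ A)
    (h1 : ∀ t, HasDerivAt Y (Y1 t) t)
    (h2 : ∀ t, HasDerivAt Y1 (-(A - Real.exp (2 * t) / 2) * Y1 t - r t) t)
    (hr : ∀ t ≤ T, 0 ≤ r t) (hB : ∀ t ≤ T, B ≤ Y t) : ∀ t ≤ T, Y1 t ≤ 0 := by
  intro t1 ht1
  by_contra hpos
  push Not at hpos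
  set ρ : ℝ → ℝ := fun t => Real.exp (A * t - Real.exp (2 * t) / 4) with hρ
  have hρpos : ∀ t, 0 < ρ t := fun t => Real.exp_pos _
  have hρd : ∀ t, HasDerivAt ρ (ρ t * (A - Real.exp (2 * t) / 2)) t := by
    intro t
    have := (((hasDerivAt_id t).const_mul A).sub ((exp2_deriv t).div_const 4)).exp
    refine HasDerivAt.congr_deriv (this) ?_
    simp only [hρ, id, Pi.sub_apply]
    ring
  have hφ := drift (g := fun t => ρ t * Y1 t) (g' := fun t => - (ρ t * r t)) (T := t1) (c := 0)
    (by
      intro t ht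
      refine HasDerivAt.congr_deriv ((hρd t).mul (h2 t)) ?_
      ring)
    (by
      intro t ht
      have := mul_nonneg (hρpos t).le (hr t (ht.trans ht1))
      try simp only
      linarith)
  have hk : 0 < ρ t1 * Y1 t1 / Real.exp (A * t1) :=
    div_pos (mul_pos (hρpos t1) hpos) (Real.exp_pos _)
  refine drift_false (g := fun t => - Y t) (g' := fun t => - Y1 t) (T := t1)
    (B := -B) (c := ρ t1 * Y1 t1 / Real.exp (A * t1)) (fun t _ => (h1 t).neg) ?_ hk ?_
  · intro t ht
    have h3 := hφ t ht
    simp only [zero_mul, add_zero] at h3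
    have h4 : ρ t ≤ Real.exp (A * t1) := by
      apply Real.exp_le_exp.mpr
      have := Real.exp_pos (2 * t)
      have := mul_le_mul_of_nonneg_left ht hA
      linarith
    have h5 : 0 < ρ t * Y1 t := lt_of_lt_of_le (mul_pos (hρpos t1) hpos) h3
    have h6 : 0 < Y1 t := by
      by_contra hn
      push Not at hn
      have := mul_nonneg (hρpos t).le (neg_nonneg.mpr hn)
      linarith
    have : ρ t1 * Y1 t1 / Real.exp (A * t1) ≤ Y1 t := by
      rw [div_le_iff₀ (Real.exp_pos _)]
      nlinarith
    linarith
  · intro t ht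
    have := hB t (ht.trans ht1)
    linarith

/-- Emden-Fowler form of the equation -/
structure Sol_s12 (p α A L : ℝ) (V V1 : ℝ → ℝ) : Prop where
  hp : 1 < p
  hα : 0 < α
  hA : 0 ≤ A
  hL : 0 < L
  hLp : L ^ (p - 1) = α * (A + α)
  pos : ∀ t, 0 < V t
  d1 : ∀ t, HasDerivAt V (V1 t) t
  d2 : ∀ t, HasDerivAt V1 (-(A - Real.exp (2 * t) / 2) * V1 t -
    V t * (V t ^ (p - 1) - L ^ (p - 1))) t

namespace Sol_s12

variable {p α A L : ℝ} {V V1 : ℝ → ℝ}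

theorem qderiv (S : Sol_s12 p α A L V V1) (t : ℝ) : HasDerivAt (fun t => V1 t / V t)
    (-(V1 t / V t) ^ 2 - (A - Real.exp (2 * t) / 2) * (V1 t / V t) + L ^ (p - 1)
      - V t ^ (p - 1)) t := by
  have hV := (S.pos t).ne'
  refine HasDerivAt.congr_deriv ((S.d2 t).div (S.d1 t) hV) ?_
  field_simp
  ring

theorem powderiv (S : Sol_s12 p α A L V V1) (t : ℝ) : HasDerivAt (fun t => V t ^ (p - 1))
    ((p - 1) * V t ^ (p - 1) * (V1 t / V t)) t := by
  have hV := (S.pos t)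
  refine HasDerivAt.congr_deriv ((S.d1 t).rpow_const (p := p - 1) (Or.inl hV.ne')) ?_
  rw [Real.rpow_sub_one hV.ne' (p - 1)]
  field_simp

theorem bdd (S : Sol_s12 p α A L V V1) {T : ℝ} (h1 : ∀ t ≤ T, 0 ≤ V1 t)
    (hsm : ∀ ε > 0, ∃ T' ≤ T, ∀ t ≤ T', V t ≤ ε) :
    ∃ T' B, ∀ t ≤ T', Real.exp (-α * t) * V t ≤ B := by
  have hα := S.hα
  have hA := S.hA
  have hp := S.hp
  have hα' : 0 < A + α := by linarith
  set M := 2 / (A + α) with hM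
  have hMpos : 0 < M := by positivity
  have hM1 : M * (A + α) = 2 := by rw [hM]; field_simp
  obtain ⟨T', hT', hsmall⟩ := hsm ((α / (2 * M)) ^ (1 / (p - 1))) (by positivity)
  have hs2 : ∀ t ≤ T', M * V t ^ (p - 1) ≤ α / 2 := by
    intro t ht
    have h3 := Real.rpow_le_rpow (S.pos t).le (hsmall t ht) (show 0 ≤ p - 1 by linarith)
    rw [← Real.rpow_mul (by positivity), one_div_mul_cancel (by linarith), Real.rpow_one] at h3
    calc M * V t ^ (p - 1) ≤ M * (α / (2 * M)) := by gcongr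
      _ = α / 2 := by field_simp
  have hq0 : ∀ t ≤ T', 0 ≤ V1 t / V t := fun t ht =>
    div_nonneg (h1 t (ht.trans hT')) (S.pos t).le
  have hg : ∀ t ≤ T', α - V1 t / V t - M * V t ^ (p - 1) ≤ 0 := by
    apply back_growth (B := α) (g := fun t => α - V1 t / V t - M * V t ^ (p - 1))
      (fun t _ => ((S.qderiv t).const_sub α).sub ((S.powderiv t).const_mul M))
    · intro t ht
      have := hq0 t ht
      have : 0 ≤ M * V t ^ (p - 1) := mul_nonneg hMpos.le (Real.rpow_nonneg (S.pos t).le _)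
      try simp only
      linarith
    · intro η hη
      refine ⟨(A + α) / 2 * η, by positivity, ?_⟩
      intro t ht hgt
      have hq := hq0 t ht
      have hP : 0 ≤ V t ^ (p - 1) := Real.rpow_nonneg (S.pos t).le _
      rw [S.hLp]
      set q := V1 t / V t
      set P := V t ^ (p - 1)
      have he := Real.exp_pos (2 * t)
      set e := Real.exp (2 * t)
      have x1 : 0 ≤ e * q := by positivity
      have x2 : 0 ≤ M * ((p - 1) * P * q) := by
        have : 0 ≤ p - 1 := by linarith
        positivity
      have x3 : 0 ≤ M * P := by positivity
      have x4 : 0 ≤ q * (α - q) := mul_nonneg hq (by linarith)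
      have x5 : P = (A + α) / 2 * (M * P) := by
        rw [← mul_assoc]
        rw [show (A + α) / 2 * M = 1 by linarith]
        ring
      have x6 : (A + α) / 2 * (M * P + η) ≤ (A + α) / 2 * (α - q) := by
        apply mul_le_mul_of_nonneg_left _ (by linarith)
        linarith
      nlinarith
  set K := 2 * M / ((p - 1) * α) with hK
  have hp1 : 0 < p - 1 := by linarith
  have hKpos : 0 < K := by positivity
  have hK1 : K * (p - 1) * α = 2 * M := by rw [hK]; field_simp
  have hh := drift (g := fun t => -(Real.log (V t) - α * t + K * V t ^ (p - 1)))
    (T := T') (c := 0)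
    (fun t _ => ((((S.d1 t).log (S.pos t).ne').sub ((hasDerivAt_id t).const_mul α)).add
      ((S.powderiv t).const_mul K)).neg)
    (by
      intro t ht
      have hq := hg t ht
      have hP : 0 ≤ V t ^ (p - 1) := Real.rpow_nonneg (S.pos t).le _
      have hs := hs2 t ht
      set q := V1 t / V t
      set P := V t ^ (p - 1)
      have x1 : K * ((p - 1) * P * (α / 2)) ≤ K * ((p - 1) * P * q) := by
        apply mul_le_mul_of_nonneg_left _ hKpos.le
        apply mul_le_mul_of_nonneg_left _ (by positivity)
        linarith
      have x2 : K * ((p - 1) * P * (α / 2)) = M * P := by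
        linear_combination (P / 2) * hK1
      linarith)
  refine ⟨T', Real.exp (Real.log (V T') - α * T' + K * V T' ^ (p - 1)), ?_⟩
  intro t ht
  have h5 := hh t ht
  try simp only at h5
  have hP : 0 ≤ K * V t ^ (p - 1) := mul_nonneg hKpos.le (Real.rpow_nonneg (S.pos t).le _)
  rw [← Real.exp_log (S.pos t), ← Real.exp_add]
  apply Real.exp_le_exp.mpr
  linarith

theorem caseGe (S : Sol_s12 p α A L V V1) {T : ℝ} (h : ∀ t ≤ T, L ≤ V t) : ∀ t ≤ T, V t = L := by
  have hA := S.hA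
  have hL := S.hL
  have hp1 : 0 < p - 1 := by linarith [S.hp]
  have hf : ∀ t ≤ T, 0 ≤ V t * (V t ^ (p - 1) - L ^ (p - 1)) := by
    intro t ht
    apply mul_nonneg (S.pos t).le
    have := Real.rpow_le_rpow hL.le (h t ht) hp1.le
    linarith
  have hV1 := sign_lemma (T := T) (B := 0) hA S.d1 S.d2 hf (fun t _ => (S.pos t).le)
  have hmono := drift (T := T) (c := 0) (fun t _ => S.d1 t) (by simpa using hV1)
  have hanti : ∀ s ≤ T, ∀ t ≤ s, V s ≤ V t := by
    intro s hs t ht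
    have := drift (T := s) (c := 0) (fun t _ => S.d1 t)
      (by simpa using (fun t (ht : t ≤ s) => hV1 t (ht.trans hs))) t ht
    linarith
  intro t1 ht1
  by_contra hne
  have hgt : L < V t1 := lt_of_le_of_ne (h t1 ht1) (Ne.symm hne)
  have hk : 0 < L * (V t1 ^ (p - 1) - L ^ (p - 1)) := by
    apply mul_pos hL
    have := Real.rpow_lt_rpow hL.le hgt hp1
    linarith
  set k := L * (V t1 ^ (p - 1) - L ^ (p - 1)) with hkdef
  have hfk : ∀ t ≤ t1, k ≤ V t * (V t ^ (p - 1) - L ^ (p - 1)) := by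
    intro t ht
    have a1 := hanti t1 ht1 t ht
    have a2 := Real.rpow_le_rpow (S.pos t1).le a1 hp1.le
    have a3 := Real.rpow_lt_rpow hL.le hgt hp1
    apply mul_le_mul _ _ _ (S.pos t).le <;> linarith
  have hg : ∀ t ≤ t1, HasDerivAt (fun t => V1 t + (A - Real.exp (2 * t) / 2) * V t)
      (- (V t * (V t ^ (p - 1) - L ^ (p - 1))) - Real.exp (2 * t) * V t) t := by
    intro t _
    refine HasDerivAt.congr_deriv ((S.d2 t).add ((((exp2_deriv t).div_const 2).const_sub A).mul (S.d1 t))) ?_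
    ring
  have hg2 : ∀ t ≤ t1, (- (V t * (V t ^ (p - 1) - L ^ (p - 1))) - Real.exp (2 * t) * V t) ≤ -k := by
    intro t ht
    have := hfk t ht
    have := mul_pos (Real.exp_pos (2 * t)) (S.pos t)
    linarith
  have hgle : ∀ t ≤ t1, V1 t + (A - Real.exp (2 * t) / 2) * V t ≤ A * V t := by
    intro t ht
    have := hV1 t (ht.trans ht1)
    have := mul_pos (Real.exp_pos (2 * t)) (S.pos t)
    linarith
  -- V is unbounded
  have hunb : ∀ B, ∃ t ≤ t1, B ≤ V t := by
    intro B
    by_contra hcon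
    push Not at hcon
    refine drift_false (B := A * B) hg hg2 hk ?_
    intro t ht
    refine (hgle t ht).trans ?_
    exact mul_le_mul_of_nonneg_left (hcon t ht).le hA
  obtain ⟨t2, ht2, hVt2⟩ := hunb ((L ^ (p - 1) + A ^ 2 + 1) ^ (1 / (p - 1)))
  have hLP : 0 < L ^ (p - 1) := Real.rpow_pos_of_pos hL _
  have hbig : ∀ t ≤ t2, L ^ (p - 1) + A ^ 2 + 1 ≤ V t ^ (p - 1) := by
    intro t ht
    have a1 := hVt2.trans (hanti t2 (ht2.trans ht1) t ht)
    have h3 := Real.rpow_le_rpow (by positivity) a1 hp1.le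
    rwa [← Real.rpow_mul (by positivity), one_div_mul_cancel (by linarith), Real.rpow_one] at h3
  refine drift_false (T := t2) (c := 1) (B := 0) (fun t _ => S.qderiv t) ?_ one_pos ?_
  · intro t ht
    have hq : V1 t / V t ≤ 0 :=
      div_nonpos_of_nonpos_of_nonneg (hV1 t ((ht.trans ht2).trans ht1)) (S.pos t).le
    have := hbig t ht
    have he := mul_nonneg (Real.exp_pos (2 * t)).le (neg_nonneg.mpr hq)
    nlinarith [sq_nonneg (V1 t / V t + A), sq_nonneg (V1 t / V t)]
  · intro t ht
    exact div_nonpos_of_nonpos_of_nonneg (hV1 t ((ht.trans ht2).trans ht1)) (S.pos t).le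

theorem caseLe (S : Sol_s12 p α A L V V1) {T : ℝ} (h : ∀ t ≤ T, V t ≤ L) :
    (∀ t ≤ T, V t = L) ∨ ∃ T' B, ∀ t ≤ T', Real.exp (-α * t) * V t ≤ B := by
  have hA := S.hA
  have hL := S.hL
  have hp1 : 0 < p - 1 := by linarith [S.hp]
  have hV1 : ∀ t ≤ T, 0 ≤ V1 t := by
    have := sign_lemma (Y := fun t => - V t) (Y1 := fun t => - V1 t)
      (r := fun t => - (V t * (V t ^ (p - 1) - L ^ (p - 1)))) (T := T) (B := -L) hA
      (fun t => (S.d1 t).neg)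
      (fun t => by
        refine HasDerivAt.congr_deriv ((S.d2 t).neg) ?_
        ring)
      (fun t ht => by
        have := Real.rpow_le_rpow (S.pos t).le (h t ht) hp1.le
        have := mul_nonneg (S.pos t).le (sub_nonneg.mpr this)
        linarith)
      (fun t ht => by
        have := h t ht
        linarith)
    intro t ht
    have := this t ht
    linarith
  have hmono : ∀ s ≤ T, ∀ t ≤ s, V t ≤ V s := by
    intro s hs t ht
    have := drift (g := fun t => - V t) (T := s) (c := 0) (fun t _ => (S.d1 t).neg)
      (fun t (ht : t ≤ s) => by
        have := hV1 t (ht.trans hs)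
        linarith) t ht
    linarith
  by_cases hall : ∀ t ≤ T, V t = L
  · exact Or.inl hall
  right
  push Not at hall
  obtain ⟨t1, ht1, hne⟩ := hall
  have hlt : V t1 < L := lt_of_le_of_ne (h t1 ht1) hne
  apply S.bdd hV1
  intro ε hε
  by_contra hcon
  push Not at hcon
  have hlow : ∀ t ≤ T, ε ≤ V t := by
    intro t ht
    obtain ⟨s, hs, hs2⟩ := hcon t ht
    exact hs2.le.trans (hmono t ht s hs)
  have hd : 0 < L ^ (p - 1) - V t1 ^ (p - 1) := by
    have := Real.rpow_lt_rpow (S.pos t1).le hlt hp1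
    linarith
  set k := ε * (L ^ (p - 1) - V t1 ^ (p - 1)) with hkdef
  have hk : 0 < k := mul_pos hε hd
  set t2 := min t1 (min 0 (Real.log (k / (2 * L)) / 2)) with ht2
  have h21 : t2 ≤ t1 := min_le_left _ _
  have h20 : t2 ≤ 0 := (min_le_right _ _).trans (min_le_left _ _)
  have h2l : t2 ≤ Real.log (k / (2 * L)) / 2 := (min_le_right _ _).trans (min_le_right _ _)
  have hexp : ∀ t ≤ t2, Real.exp (2 * t) * L ≤ k / 2 := by
    intro t ht
    have : Real.exp (2 * t) ≤ k / (2 * L) := by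
      rw [← Real.le_log_iff_exp_le (by positivity)]
      linarith
    calc Real.exp (2 * t) * L ≤ k / (2 * L) * L := by gcongr
      _ = k / 2 := by field_simp
  refine drift_false (g := fun t => -(V1 t + (A - Real.exp (2 * t) / 2) * V t))
    (g' := fun t => V t * (V t ^ (p - 1) - L ^ (p - 1)) + Real.exp (2 * t) * V t)
    (T := t2) (c := k / 2) (B := L) ?_ ?_ (by linarith) ?_
  · intro t _
    refine HasDerivAt.congr_deriv (((S.d2 t).add ((((exp2_deriv t).div_const 2).const_sub A).mul (S.d1 t))).neg) ?_
    ring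
  · intro t ht
    have a1 := hmono t1 ht1 t (ht.trans h21)
    have a2 := Real.rpow_le_rpow (S.pos t).le a1 hp1.le
    have a3 := hlow t ((ht.trans h21).trans ht1)
    have a4 := hexp t ht
    have a5 : Real.exp (2 * t) * V t ≤ Real.exp (2 * t) * L := by
      gcongr
      exact h t ((ht.trans h21).trans ht1)
    have a6 : k ≤ V t * (L ^ (p - 1) - V t ^ (p - 1)) := by
      apply mul_le_mul a3 _ hd.le (S.pos t).le
      linarith
    try simp only
    linarith
  · intro t ht
    have a0 := hV1 t ((ht.trans h21).trans ht1)
    have a1 : Real.exp (2 * t) ≤ 1 := Real.exp_le_one_iff.mpr (by linarith)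
    have a2 := h t ((ht.trans h21).trans ht1)
    have a3 := mul_nonneg hA (S.pos t).le
    have a4 : Real.exp (2 * t) * V t ≤ 1 * V t := mul_le_mul_of_nonneg_right a1 (S.pos t).le
    have a5 := S.pos t
    try simp only
    nlinarith

/-- potential, normalised to vanish at `L` -/
noncomputable def G (p L : ℝ) (V V1 : ℝ → ℝ) (t : ℝ) : ℝ :=
  V1 t ^ 2 / 2 + (V t ^ (p + 1) / (p + 1) - L ^ (p - 1) * V t ^ 2 / 2
    - (L ^ (p + 1) / (p + 1) - L ^ (p - 1) * L ^ 2 / 2))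

theorem rpow_add_two {x : ℝ} (hx : 0 < x) (p : ℝ) : x ^ (p + 1) = x ^ (p - 1) * x ^ 2 := by
  rw [← Real.rpow_natCast x 2, ← Real.rpow_add hx]
  congr 1
  push_cast
  ring

theorem G_ge (S : Sol_s12 p α A L V V1) (t : ℝ) : V1 t ^ 2 / 2 ≤ G p L V V1 t := by
  have hp := S.hp
  have hL := S.hL
  have hV := S.pos t
  have hb := one_add_mul_self_le_rpow_one_add (s := (V t / L) ^ 2 - 1) (by nlinarith [sq_nonneg (V t / L)])
    (p := (p + 1) / 2) (by linarith)
  have e1 : (1 + ((V t / L) ^ 2 - 1)) ^ ((p + 1) / 2) = V t ^ (p + 1) / L ^ (p + 1) := by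
    rw [add_sub_cancel, ← Real.rpow_natCast, ← Real.rpow_mul (by positivity),
      Real.div_rpow hV.le hL.le]
    congr 2 <;> push_cast <;> ring
  rw [e1, le_div_iff₀ (by positivity)] at hb
  unfold G
  have hLL := rpow_add_two hL p
  have e2 : (1 + (p + 1) / 2 * ((V t / L) ^ 2 - 1)) * L ^ (p + 1) =
      L ^ (p + 1) + (p + 1) / 2 * (L ^ (p - 1) * V t ^ 2 - L ^ (p + 1)) := by
    rw [hLL]
    field_simp
  rw [e2] at hb
  have hp1 : 0 < p + 1 := by linarith
  have e3 : V t ^ (p + 1) / (p + 1) - L ^ (p - 1) * V t ^ 2 / 2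
    - (L ^ (p + 1) / (p + 1) - L ^ (p - 1) * L ^ 2 / 2) =
    (V t ^ (p + 1) - (L ^ (p + 1) + (p + 1) / 2 * (L ^ (p - 1) * V t ^ 2 - L ^ (p + 1)))) / (p + 1) := by
    rw [← hLL]
    field_simp
    ring
  rw [e3]
  have : 0 ≤ (V t ^ (p + 1) - (L ^ (p + 1) + (p + 1) / 2 * (L ^ (p - 1) * V t ^ 2 - L ^ (p + 1)))) / (p + 1) :=
    div_nonneg (by linarith) hp1.le
  linarith

theorem G_deriv (S : Sol_s12 p α A L V V1) (t : ℝ) :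
    HasDerivAt (G p L V V1) (-(A - Real.exp (2 * t) / 2) * V1 t ^ 2) t := by
  have hp := S.hp
  have hV := S.pos t
  have h := ((((S.d2 t).pow 2).div_const 2).add
    (((((S.d1 t).rpow_const (p := p + 1) (Or.inl hV.ne')).div_const (p + 1)).sub
      ((((S.d1 t).pow 2).const_mul (L ^ (p - 1))).div_const 2)).sub_const
      (L ^ (p + 1) / (p + 1) - L ^ (p - 1) * L ^ 2 / 2)))
  unfold G
  refine HasDerivAt.congr_deriv (h) ?_
  have hp1 : p + 1 ≠ 0 := by linarith
  have e : V t ^ (p + 1 - 1) = V t ^ (p - 1) * V t := by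
    rw [show p + 1 - 1 = (p - 1) + 1 by ring, Real.rpow_add_one hV.ne']
  rw [e]
  field_simp
  push_cast
  ring

theorem finish_s12 (S : Sol_s12 p α A L V V1) (h : ∀ T, ∃ t ≤ T, G p L V V1 t ≤ 0) : ∀ t, V t = L := by
  have hV1 : ∀ t, V1 t = 0 := by
    intro t
    obtain ⟨s, hs, hG⟩ := h t
    have hd : ∀ x, HasDerivAt (fun x => G p L V V1 x * Real.exp (-(Real.exp (2 * x) / 2)))
        (Real.exp (-(Real.exp (2 * x) / 2)) * (-(A - Real.exp (2 * x) / 2) * V1 x ^ 2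
          - Real.exp (2 * x) * G p L V V1 x)) x := by
      intro x
      refine HasDerivAt.congr_deriv ((S.G_deriv x).mul (((exp2_deriv x).div_const 2).neg.exp)) ?_
      simp only [Pi.neg_apply]
      ring
    have hanti : Antitone (fun x => G p L V V1 x * Real.exp (-(Real.exp (2 * x) / 2))) := by
      apply antitone_of_hasDerivAt_nonpos hd
      intro x
      apply mul_nonpos_of_nonneg_of_nonpos (Real.exp_pos _).le
      have a1 := S.G_ge x
      have a2 := mul_le_mul_of_nonneg_left a1 (Real.exp_pos (2 * x)).le
      have a3 := mul_nonneg S.hA (sq_nonneg (V1 x))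
      linarith
    have h1 := hanti hs
    simp only at h1
    have h2 : G p L V V1 s * Real.exp (-(Real.exp (2 * s) / 2)) ≤ 0 :=
      mul_nonpos_of_nonpos_of_nonneg hG (Real.exp_pos _).le
    have h3 : G p L V V1 t ≤ 0 := by
      by_contra hc
      push Not at hc
      have := mul_pos hc (Real.exp_pos (-(Real.exp (2 * t) / 2)))
      linarith
    have h4 := S.G_ge t
    have : V1 t ^ 2 = 0 := le_antisymm (by linarith) (sq_nonneg _)
    exact pow_eq_zero_iff (two_ne_zero) |>.mp this
  intro t
  have h2 := S.d2 t
  have hz : V1 = fun _ => 0 := funext hV1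
  rw [hz] at h2
  have h3 := h2.unique (hasDerivAt_const t (0:ℝ))
  simp only [mul_zero, zero_sub, neg_eq_zero, mul_eq_zero, (S.pos t).ne', false_or] at h3
  have hp1 : 0 < p - 1 := by linarith [S.hp]
  exact (Real.rpow_left_inj (S.pos t).le S.hL.le hp1.ne').mp (by linarith)

theorem finish' (S : Sol_s12 p α A L V V1) {T : ℝ} (h : ∀ t ≤ T, V t = L) : ∀ t, V t = L := by
  apply S.finish_s12
  intro T'
  refine ⟨min T' (T - 1), min_le_left _ _, ?_⟩
  set s := min T' (T - 1)
  have hs : s < T := lt_of_le_of_lt (min_le_right _ _) (by linarith)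
  have hV1 : V1 s = 0 := by
    refine (S.d1 s).unique ?_
    refine (hasDerivAt_const s L).congr_of_eventuallyEq ?_
    filter_upwards [Iio_mem_nhds hs] with x hx
    exact h x (le_of_lt hx)
  unfold G
  rw [hV1, h s hs.le]
  simp


theorem osc_s12 (S : Sol_s12 p α A L V V1) (hApos : 0 < A)
    (hlo : ∀ T, ∃ t < T, V t < L) (hhi : ∀ T, ∃ t < T, L < V t) : ∀ t, V t = L := by
  have hL := S.hL
  have hp := S.hp
  have hp1 : 0 < p - 1 := by linarith
  have hLP : 0 < L ^ (p - 1) := Real.rpow_pos_of_pos hL _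
  -- region where the damping is positive
  set t0 := Real.log A / 2 with ht0
  have hexp : ∀ t ≤ t0, Real.exp (2 * t) ≤ A := by
    intro t ht
    rw [← Real.le_log_iff_exp_le hApos]
    linarith
  set E := G p L V V1 with hE
  have hanti : ∀ s ≤ t0, ∀ t ≤ s, E s ≤ E t := by
    intro s hs t ht
    have := drift (T := s) (c := 0) (fun t _ => S.G_deriv t)
      (fun x hx => by
        have := hexp x (hx.trans hs)
        have := mul_nonneg (show 0 ≤ A - Real.exp (2 * x) / 2 by linarith) (sq_nonneg (V1 x))
        linarith) t ht
    rw [hE]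
    linarith
  set E0 := L ^ (p - 1) * L ^ 2 / 2 - L ^ (p + 1) / (p + 1) with hE0
  have hEle : ∀ t ≤ t0, E t ≤ E0 := by
    intro t ht
    obtain ⟨a, ha, hVa⟩ := hhi t
    obtain ⟨b, hb, hVb⟩ := hlo a
    obtain ⟨c, hc, hVc⟩ := hhi b
    have hcont : ContinuousOn V (Icc c a) := fun x _ => (S.d1 x).continuousAt.continuousWithinAt
    obtain ⟨m, hm, hmin⟩ := isCompact_Icc.exists_isMinOn ⟨b, hc.le, hb.le⟩ hcont
    have hmb : V m ≤ V b := hmin ⟨hc.le, hb.le⟩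
    have hmc : c < m := lt_of_le_of_ne hm.1 (by rintro rfl; linarith)
    have hma : m < a := lt_of_le_of_ne hm.2 (by rintro rfl; linarith)
    have hloc : IsLocalMin V m := hmin.isLocalMin (Icc_mem_nhds hmc hma)
    have hV1m : V1 m = 0 := hloc.hasDerivAt_eq_zero (S.d1 m)
    refine (hanti t ht m (by linarith)).trans ?_
    rw [hE, hE0]
    unfold G
    rw [hV1m, rpow_add_two (S.pos m)]
    have a1 := Real.rpow_le_rpow (S.pos m).le (show V m ≤ L by linarith) hp1.le
    have a2 : V m ^ (p - 1) * V m ^ 2 / (p + 1) ≤ L ^ (p - 1) * V m ^ 2 / 2 := by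
      apply div_le_div₀ (by positivity) (by gcongr) (by norm_num) (by linarith)
    linarith
  -- bounds
  have hVp : ∀ t ≤ t0, V t ^ (p - 1) ≤ L ^ (p - 1) * (p + 1) / 2 ∧
      V1 t ^ 2 ≤ L ^ (p - 1) * V t ^ 2 := by
    intro t ht
    have h1 := hEle t ht
    rw [hE, hE0] at h1
    unfold G at h1
    rw [rpow_add_two (S.pos t)] at h1
    have hV2 : 0 < V t ^ 2 := pow_pos (S.pos t) 2
    have hP : 0 ≤ V t ^ (p - 1) := Real.rpow_nonneg (S.pos t).le _
    have h2 : V t ^ (p - 1) * V t ^ 2 / (p + 1) ≤ L ^ (p - 1) * V t ^ 2 / 2 := by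
      linarith [sq_nonneg (V1 t)]
    have h3 : 0 ≤ V t ^ (p - 1) * V t ^ 2 / (p + 1) := by positivity
    constructor
    · rw [div_le_iff₀ (by linarith)] at h2
      have : V t ^ (p - 1) * V t ^ 2 ≤ (L ^ (p - 1) * (p + 1) / 2) * V t ^ 2 := by linarith
      exact le_of_mul_le_mul_right this hV2
    · linarith
  set Q := L ^ (p - 1) * (p + 1) / 2 with hQ
  have hQpos : 0 < Q := by positivity
  set K := Q ^ (1 / (p - 1)) with hK
  have hKpos : 0 < K := by positivity
  have hVK : ∀ t ≤ t0, V t ≤ K := by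
    intro t ht
    have := Real.rpow_le_rpow (Real.rpow_nonneg (S.pos t).le _) (hVp t ht).1
      (show 0 ≤ 1 / (p - 1) by positivity)
    rwa [← Real.rpow_mul (S.pos t).le, mul_one_div_cancel hp1.ne', Real.rpow_one] at this
  set C1 := Real.sqrt (L ^ (p - 1)) * K with hC1
  have hC1pos : 0 < C1 := by positivity
  have hV1b : ∀ t ≤ t0, |V1 t| ≤ C1 := by
    intro t ht
    refine abs_le_of_sq_le_sq ?_ hC1pos.le
    rw [hC1, mul_pow, Real.sq_sqrt hLP.le]
    refine (hVp t ht).2.trans ?_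
    have := hVK t ht
    have := (S.pos t).le
    gcongr
  set C := A * C1 + K * (Q + L ^ (p - 1)) with hC
  have hCpos : 0 < C := by positivity
  have hV2b : ∀ t ≤ t0, |-(A - Real.exp (2 * t) / 2) * V1 t -
      V t * (V t ^ (p - 1) - L ^ (p - 1))| ≤ C := by
    intro t ht
    refine (abs_sub _ _).trans ?_
    rw [abs_mul, abs_mul, abs_neg]
    have e1 := hexp t ht
    have e2 := Real.exp_pos (2 * t)
    have b1 : |A - Real.exp (2 * t) / 2| ≤ A := by
      rw [abs_le]; constructor <;> linarith
    have b2 : |V t| ≤ K := by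
      rw [abs_of_pos (S.pos t)]; exact hVK t ht
    have b3 : |V t ^ (p - 1) - L ^ (p - 1)| ≤ Q + L ^ (p - 1) := by
      have := (hVp t ht).1
      have : 0 ≤ V t ^ (p - 1) := Real.rpow_nonneg (S.pos t).le _
      rw [abs_le]; constructor <;> linarith
    have b4 := hV1b t ht
    rw [hC]
    gcongr
  apply S.finish_s12
  intro T
  by_contra hcon
  push Not at hcon
  set tE := min T t0 with htE
  have htE0 : tE ≤ t0 := min_le_right _ _
  have hγ : 0 < E tE := hcon tE (min_le_left _ _)
  set γ := E tE with hγd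
  set η := Real.sqrt (2 * γ) with hη
  have hηpos : 0 < η := Real.sqrt_pos.mpr (by linarith)
  have hη2 : η ^ 2 = 2 * γ := Real.sq_sqrt (by linarith)
  set δ := η / (2 * C) with hδ
  have hδpos : 0 < δ := by positivity
  have hCδ : C * δ = η / 2 := by rw [hδ]; field_simp
  -- energy jump near each crossing
  set κ := A / 2 * (η / 2) ^ 2 * δ with hκ
  have hκpos : 0 < κ := by positivity
  have hjump : ∀ s ≤ tE, V s = L → E s + κ ≤ E (s - δ) := by
    intro s hs hVs
    have hs0 := hs.trans htE0
    have hEs : γ ≤ E s := hanti tE htE0 s hs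
    have hEs2 : E s = V1 s ^ 2 / 2 := by
      rw [hE]; unfold G; rw [hVs]; ring
    have hV1s : η ≤ |V1 s| := by
      apply Real.sqrt_le_iff.mpr
      refine ⟨abs_nonneg _, ?_⟩
      rw [sq_abs]
      linarith
    have hξ : ∀ ξ ∈ Icc (s - δ) s, η / 2 ≤ |V1 ξ| := by
      intro ξ hξ
      have hmv := (convex_Iic t0).norm_image_sub_le_of_norm_hasDerivWithin_le
        (fun x _ => (S.d2 x).hasDerivWithinAt)
        (fun x hx => by rw [Real.norm_eq_abs]; exact hV2b x hx)
        (show ξ ∈ Iic t0 from hξ.2.trans hs0) (show s ∈ Iic t0 from hs0)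
      rw [Real.norm_eq_abs, Real.norm_eq_abs, abs_of_nonneg (by linarith [hξ.2] : 0 ≤ s - ξ)] at hmv
      have : C * (s - ξ) ≤ C * δ := by
        apply mul_le_mul_of_nonneg_left _ hCpos.le
        linarith [hξ.1]
      have h5 := abs_sub_abs_le_abs_sub (V1 s) (V1 ξ)
      linarith
    have hant : AntitoneOn (fun x => E x + (A / 2 * (η / 2) ^ 2) * x) (Icc (s - δ) s) := by
      apply antitoneOn_of_hasDerivWithinAt_nonpos
        (f' := fun x => -(A - Real.exp (2 * x) / 2) * V1 x ^ 2 + (A / 2 * (η / 2) ^ 2) * 1)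
        (convex_Icc _ _)
      · intro x hx
        exact ((S.G_deriv x).add ((hasDerivAt_id x).const_mul _)).continuousAt.continuousWithinAt
      · intro x hx
        exact ((S.G_deriv x).add ((hasDerivAt_id x).const_mul _)).hasDerivWithinAt
      · intro x hx
        rw [interior_Icc] at hx
        have c1 := hξ x ⟨hx.1.le, hx.2.le⟩
        have c2 := hexp x (hx.2.le.trans hs0)
        have c3 : (η / 2) ^ 2 ≤ V1 x ^ 2 := by
          rw [← sq_abs (V1 x)]
          gcongr
        have c4 : A / 2 * (η / 2) ^ 2 ≤ (A - Real.exp (2 * x) / 2) * V1 x ^ 2 := by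
          apply mul_le_mul (by linarith) c3 (by positivity) (by linarith)
        linarith
    have := hant (show s - δ ∈ Icc (s - δ) s from ⟨le_rfl, by linarith⟩)
      (show s ∈ Icc (s - δ) s from ⟨by linarith, le_rfl⟩) (by linarith)
    simp only at this
    rw [hκ]
    linarith
  have hind : ∀ k : ℕ, ∃ t ≤ tE, γ + k * κ ≤ E t := by
    intro k
    induction k with
    | zero => exact ⟨tE, le_rfl, by simp [hγd]⟩
    | succ k ih =>
      obtain ⟨t, ht, hEt⟩ := ih
      obtain ⟨a, ha, hVa⟩ := hhi t
      obtain ⟨b, hb, hVb⟩ := hlo a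
      have hcont : ContinuousOn V (Icc b a) :=
        fun x _ => (S.d1 x).continuousAt.continuousWithinAt
      obtain ⟨s, hs, hVs⟩ := intermediate_value_Icc hb.le hcont ⟨hVb.le, hVa.le⟩
      have hst : s ≤ t := by linarith [hs.2]
      refine ⟨s - δ, by linarith, ?_⟩
      have g1 := hjump s (by linarith) hVs
      have g2 := hanti t (ht.trans htE0) s hst
      push_cast
      linarith
  obtain ⟨k, hk⟩ := exists_nat_gt ((E0 - γ) / κ)
  rw [div_lt_iff₀ hκpos] at hk
  obtain ⟨t, ht, hEt⟩ := hind k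
  have := hEle t (ht.trans htE0)
  linarith

/-- an alternating sequence from oscillation -/
theorem alt {D : ℝ → ℝ} (hlo : ∀ T, ∃ t < T, D t < 0) (hhi : ∀ T, ∃ t < T, 0 < D t) :
    ∃ s : ℕ → ℝ, ∀ k, s (k + 1) < s k ∧ D (s (k + 1)) * D (s k) < 0 := by
  have hn : ∀ x : {t // D t ≠ 0}, ∃ y : {t // D t ≠ 0}, y.1 < x.1 ∧ D y.1 * D x.1 < 0 := by
    rintro ⟨x, hx⟩
    rcases lt_or_gt_of_ne hx with h | h
    · obtain ⟨y, hy, hy2⟩ := hhi x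
      exact ⟨⟨y, hy2.ne'⟩, hy, mul_neg_of_pos_of_neg hy2 h⟩
    · obtain ⟨y, hy, hy2⟩ := hlo x
      exact ⟨⟨y, hy2.ne⟩, hy, mul_neg_of_neg_of_pos hy2 h⟩
  choose nx hnx using hn
  obtain ⟨x0, -, hx0⟩ := hlo 0
  refine ⟨fun k => (nx^[k] ⟨x0, hx0.ne⟩).1, fun k => ?_⟩
  simp only [Function.iterate_succ_apply']
  exact hnx _

theorem main (S : Sol_s12 p α A L V V1)
    (hunb : ¬ ∃ T' B, ∀ t ≤ T', Real.exp (-α * t) * V t ≤ B)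
    (hs : A = 0 → ∃ N : ℕ, ∀ t : Fin (N + 1) → ℝ, StrictMono t →
        ∃ i : Fin N, 0 ≤ (V (t i.castSucc) - L) * (V (t i.succ) - L)) : ∀ t, V t = L := by
  by_cases hge : ∃ T, ∀ t < T, L ≤ V t
  · obtain ⟨T, hT⟩ := hge
    exact S.finish' (S.caseGe (T := T - 1) (fun t ht => hT t (by linarith)))
  by_cases hle : ∃ T, ∀ t < T, V t ≤ L
  · obtain ⟨T, hT⟩ := hle
    rcases S.caseLe (T := T - 1) (fun t ht => hT t (by linarith)) with h | h
    · exact S.finish' h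
    · exact absurd h hunb
  push Not at hge hle
  rcases S.hA.lt_or_eq with hA | hA
  · exact S.osc_s12 hA hge hle
  · exfalso
    obtain ⟨N, hN⟩ := hs hA.symm
    obtain ⟨s, hs⟩ := alt (D := fun t => V t - L)
      (fun T => by
        obtain ⟨t, h1, h2⟩ := hge T
        exact ⟨t, h1, by linarith⟩)
      (fun T => by
        obtain ⟨t, h1, h2⟩ := hle T
        exact ⟨t, h1, by linarith⟩)
    have hsanti : StrictAnti s := strictAnti_nat_of_succ_lt (fun k => (hs k).1)
    obtain ⟨i, hi⟩ := hN (fun i => s (N - i)) (by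
      intro i j hij
      apply hsanti
      have h1 : (i : ℕ) < j := hij
      have := j.2
      omega)
    have h1 : N - (i.castSucc : ℕ) = (N - (i.succ : ℕ)) + 1 := by
      have := i.2
      simp only [Fin.val_castSucc, Fin.val_succ]
      omega
    rw [h1] at hi
    have := (hs (N - (i.succ : ℕ))).2
    linarith

end Sol_s12

theorem stmt12 (n : ℕ) (hn : 2 < n) (p : ℝ) (hp : ((n : ℝ) + 2) / ((n : ℝ) - 2) ≤ p)
    (α L : ℝ) (hα : α = 2 / (p - 1)) (hL : 0 < L)
    (hLp : L ^ (p - 1) = 2 / (p - 1) ^ 2 * (((n : ℝ) - 2) * p - n))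
    (w : ℝ → ℝ) (hpos : ∀ r > 0, 0 < w r)
    (hC2 : ContDiffOn ℝ 2 w (Ioi 0))
    (heq : ∀ r > 0, deriv (deriv w) r + (((n : ℝ) - 1) / r - r / 2) * deriv w r
      - w r / (p - 1) + w r ^ p = 0)
    (hunbdd : ¬ ∃ B, ∀ r ∈ Ioo (0:ℝ) 1, w r ≤ B)
    (hsign : p = ((n : ℝ) + 2) / ((n : ℝ) - 2) →
      ∃ N : ℕ, ∀ t : Fin (N + 1) → ℝ, StrictMono t → (∀ i, 0 < t i) →
        ∃ i : Fin N,
          0 ≤ (w (t i.castSucc) - L * (t i.castSucc) ^ (-α))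
            * (w (t i.succ) - L * (t i.succ) ^ (-α))) :
    ∀ r > (0:ℝ), w r = L * r ^ (-α) := by
  have hn' : (2:ℝ) < n := by exact_mod_cast hn
  have hn2 : (0:ℝ) < (n:ℝ) - 2 := by linarith
  have hp1 : 1 < p := by
    refine lt_of_lt_of_le ?_ hp
    rw [lt_div_iff₀ hn2]
    linarith
  have hp0 : 0 < p - 1 := by linarith
  have hαpos : 0 < α := by rw [hα]; positivity
  have hαp : α * (p - 1) = 2 := by rw [hα]; field_simp
  have hA : (n:ℝ) - 2 - 2 * α = (((n:ℝ) - 2) * p - (n + 2)) / (p - 1) := by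
    rw [hα]; field_simp; ring
  have hA0 : 0 ≤ (n:ℝ) - 2 - 2 * α := by
    rw [hA]
    rw [div_le_iff₀ hn2] at hp
    apply div_nonneg _ hp0.le
    linarith
  have hLp' : L ^ (p - 1) = α * ((n:ℝ) - 2 - 2 * α + α) := by
    rw [hLp, hα]; field_simp; ring
  -- differentiability
  have hd1 : ∀ r > 0, HasDerivAt w (deriv w r) r := by
    intro r hr
    exact ((hC2.contDiffAt (Ioi_mem_nhds hr)).differentiableAt (by norm_num)).hasDerivAt
  have hd2 : ∀ r > 0, HasDerivAt (deriv w) (deriv (deriv w) r) r := by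
    intro r hr
    have h1 : ContDiffOn ℝ 1 (deriv w) (Ioi 0) :=
      hC2.deriv_of_isOpen isOpen_Ioi (by norm_num)
    exact ((h1.contDiffAt (Ioi_mem_nhds hr)).differentiableAt (by norm_num)).hasDerivAt
  set V : ℝ → ℝ := fun t => Real.exp (α * t) * w (Real.exp t) with hV
  set V1 : ℝ → ℝ := fun t => α * (Real.exp (α * t) * w (Real.exp t)) +
    Real.exp (α * t) * (Real.exp t * deriv w (Real.exp t)) with hV1
  have hexpα : ∀ t, HasDerivAt (fun t => Real.exp (α * t)) (α * Real.exp (α * t)) t := by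
    intro t
    refine HasDerivAt.congr_deriv (((hasDerivAt_id t).const_mul α).exp) ?_
    simp only [id]
    ring
  have hVd : ∀ t, HasDerivAt V (V1 t) t := by
    intro t
    refine HasDerivAt.congr_deriv ((hexpα t).mul
      ((hd1 (Real.exp t) (Real.exp_pos t)).comp t (Real.hasDerivAt_exp t))) ?_
    simp only [hV1, Function.comp]
    ring
  have hVp : ∀ t, 0 < V t := fun t => mul_pos (Real.exp_pos _) (hpos _ (Real.exp_pos t))
  have S : Sol_s12 p α ((n:ℝ) - 2 - 2 * α) L V V1 := by
    refine ⟨hp1, hαpos, hA0, hL, hLp', hVp, hVd, ?_⟩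
    intro t
    refine HasDerivAt.congr_deriv (((hVd t).const_mul α).add ((hexpα t).mul
      ((Real.hasDerivAt_exp t).mul
      ((hd2 (Real.exp t) (Real.exp_pos t)).comp t (Real.hasDerivAt_exp t))))) ?_
    have hw := hpos _ (Real.exp_pos t)
    have h1 := heq (Real.exp t) (Real.exp_pos t)
    have e2 : Real.exp (2 * t) = Real.exp t ^ 2 := by
      rw [← Real.exp_nat_mul]; norm_num
    have e3 : V t ^ (p - 1) = Real.exp t ^ 2 * w (Real.exp t) ^ (p - 1) := by
      simp only [hV]
      rw [Real.mul_rpow (Real.exp_pos _).le hw.le, ← Real.exp_mul, ← e2]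
      congr 2
      linear_combination t * hαp
    have e4 : w (Real.exp t) ^ p = w (Real.exp t) ^ (p - 1) * w (Real.exp t) := by
      rw [← Real.rpow_add_one hw.ne']
      congr 1
      ring
    have e5 : w (Real.exp t) / (p - 1) = α / 2 * w (Real.exp t) := by
      rw [hα]; field_simp
    rw [e3, e2, hLp']
    rw [e4, e5] at h1
    simp only [hV1, hV, Function.comp, Pi.mul_apply]
    have hr := Real.exp_pos t
    set r := Real.exp t
    set x := Real.exp (α * t)
    set P := w r ^ (p - 1)
    have h2 : deriv (deriv w) r = - ((((n : ℝ) - 1) / r - r / 2) * deriv w r)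
      + α / 2 * w r - P * w r := by linarith
    rw [h2]
    field_simp
    ring
  have hwV : ∀ t, w (Real.exp t) = Real.exp (-α * t) * V t := by
    intro t
    simp only [hV]
    rw [← mul_assoc, ← Real.exp_add]
    simp
  have hUV : ∀ t, L * Real.exp t ^ (-α) = Real.exp (-α * t) * L := by
    intro t
    rw [← Real.exp_mul, mul_comm, mul_comm t]
  have hfin := S.main (by
      rintro ⟨T, B, hB⟩
      apply hunbdd
      have hcont : ContinuousOn w (Icc (Real.exp T) 1) :=
        hC2.continuousOn.mono (fun x hx => lt_of_lt_of_le (Real.exp_pos T) hx.1)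
      obtain ⟨B', hB'⟩ := (isCompact_Icc.image_of_continuousOn hcont).bddAbove
      refine ⟨max B B', fun r hr => ?_⟩
      rcases le_total r (Real.exp T) with h | h
      · apply le_max_of_le_left
        have h3 := hB (Real.log r) ((Real.log_le_iff_le_exp hr.1).mpr h)
        rw [← hwV, Real.exp_log hr.1] at h3
        exact h3
      · apply le_max_of_le_right
        exact hB' ⟨r, ⟨h, hr.2.le⟩, rfl⟩)
    (by
      intro hA1
      rw [hA, div_eq_zero_iff] at hA1
      have hpe : p = ((n : ℝ) + 2) / ((n : ℝ) - 2) := by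
        rw [eq_div_iff hn2.ne']
        rcases hA1 with h | h <;> linarith
      obtain ⟨N, hN⟩ := hsign hpe
      refine ⟨N, fun t ht => ?_⟩
      obtain ⟨i, hi⟩ := hN (fun i => Real.exp (t i)) (Real.exp_strictMono.comp ht)
        (fun i => Real.exp_pos _)
      refine ⟨i, ?_⟩
      simp only [hwV, hUV, ← mul_sub] at hi
      by_contra hc
      push Not at hc
      have := mul_neg_of_pos_of_neg (mul_pos (Real.exp_pos (-α * t i.castSucc))
        (Real.exp_pos (-α * t i.succ))) hc
      linarith)
  intro r hr
  rw [← Real.exp_log hr, hwV, hUV, hfin]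
end
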